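/- arXiv:1609.09634 — 2 statements merged into one kernel-verified Lean document; each statement's English description precedes it below -/
import Mathlib

section
/- (Theorem 2.) Assume the intensities are time-independent (a_{ij}(t) = a_{ij} constants), so that the quantities α_i, α = inf_i α_i and χ = sup_i Σ_j |b*_{ji}| are constants, and assume α > 0 and χ < ∞. Then for any two solutions p*, p** of the forward Kolmogorov system with ‖p*(0) − p**(0)‖_{1D} < ∞ and all t ≥ 0: e^{−χt}·‖p*(0) − p**(0)‖_{1D} ≤ ‖p*(t) − p**(t)‖_{1D} ≤ e^{−αt}·‖p*(0) − p**(0)‖_{1D}, and ‖p*(t) − p**(t)‖ ≤ 4e^{−αt}·‖z*(0) − z**(0)‖_{1D}. In particular, if π is a stationary stochastic vector (Σ_j a_{ij} π_j = 0 for every i) with ‖z_π‖_{1D} < ∞, where z_π = (π_1, π_2, ...), then any solution p with ‖z(0) − z_π‖_{1D} < ∞ satisfies ‖p(t) − π‖ ≤ 4e^{−αt}·‖z(0) − z_π‖_{1D}, so the decay parameter of the chain is at least α. -/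
open MeasureTheory intervalIntegral Filter
open scoped Topology

noncomputable section

/-- `p : ℝ → ℕ → ℝ` is a solution of the forward Kolmogorov system `dp/dt = A p(t)` for a
homogeneous chain with constant transposed intensity matrix `a`: each `p t` (for `t ≥ 0`)
is a stochastic vector and the integral form
`p_i(t) = p_i(s) + ∫_s^t Σ_j a_{ij} p_j(u) du` of the equations holds. -/
def IsKolmogorovSolution (a : ℕ → ℕ → ℝ) (p : ℝ → ℕ → ℝ) : Prop :=
  (∀ t : ℝ, 0 ≤ t → (∀ i, 0 ≤ p t i) ∧ HasSum (p t) 1) ∧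
  (∀ i : ℕ, ∀ s t : ℝ, 0 ≤ s → s ≤ t →
    p t i = p s i + ∫ u in s..t, ∑' j : ℕ, a i j * p u j)

/-- The weighted norm `‖w‖_{1D} = Σ_{k≥1} d_k |Σ_{i≥k} w_i|` (the coordinate `w 0` is not
used, and `d k` only matters for `k ≥ 1`). -/
def norm1D (d : ℕ → ℝ) (w : ℕ → ℝ) : ℝ :=
  ∑' k : ℕ, d (k + 1) * |∑' i : ℕ, w (k + 1 + i)|

/-- Summability of the series defining `‖w‖_{1D}`, i.e. `‖w‖_{1D} < ∞`. -/
def Norm1DFinite (d : ℕ → ℝ) (w : ℕ → ℝ) : Prop :=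
  Summable (fun k : ℕ => d (k + 1) * |∑' i : ℕ, w (k + 1 + i)|)

/-- Entries `b_{ij} = a_{ij} − a_{i0}` of the reduced matrix `B` (for `i, j ≥ 1`), with
the convention `b_{k,0} := 0`. -/
def bEntry (a : ℕ → ℕ → ℝ) (i j : ℕ) : ℝ :=
  if j = 0 then 0 else a i j - a i 0

/-- Entries `b*_{ij} = (d_i/d_j) Σ_{k≥i} (b_{kj} − b_{k,j−1})` of `D B D⁻¹`. -/
def bStar (d : ℕ → ℝ) (a : ℕ → ℕ → ℝ) (i j : ℕ) : ℝ :=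
  (d i / d j) * ∑' k : ℕ, (bEntry a (i + k) j - bEntry a (i + k) (j - 1))

/-- `α_i = −Σ_{j≥1} b*_{ji}`. -/
def alphaI (d : ℕ → ℝ) (a : ℕ → ℕ → ℝ) (i : ℕ) : ℝ :=
  -∑' j : ℕ, bStar d a (j + 1) i


lemma aux_step (d : ℕ → ℝ) (Q : ℕ → ℕ → ℝ) (ρ : ℝ) (hd : ∀ k, 1 ≤ d k)
    (hQ0 : ∀ k j, 0 ≤ Q k j)
    (hrow : ∀ k, Summable (fun j => Q k j))
    (hcol : ∀ j, Summable (fun k => d k * Q k j))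
    (hcolle : ∀ j, ∑' k, d k * Q k j ≤ ρ * d j)
    (g : ℕ → ℝ) (hg0 : ∀ j, 0 ≤ g j) (hg : Summable (fun j => d j * g j)) :
    (∀ k, Summable (fun j => Q k j * g j)) ∧
    Summable (fun k => d k * ∑' j, Q k j * g j) ∧
    ∑' k, d k * ∑' j, Q k j * g j ≤ ρ * ∑' j, d j * g j := by
  have hgb : ∀ j, g j ≤ ∑' j, d j * g j := by
    intro j
    have h1 : d j * g j ≤ ∑' j, d j * g j :=
      hg.le_tsum j (fun i _ => mul_nonneg (by linarith [hd i]) (hg0 i))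
    nlinarith [hd j, hg0 j]
  have hs : ∀ k, Summable (fun j => Q k j * g j) := by
    intro k
    refine Summable.of_nonneg_of_le (fun j => mul_nonneg (hQ0 k j) (hg0 j))
      (fun j => mul_le_mul_of_nonneg_left (hgb j) (hQ0 k j)) ((hrow k).mul_right _)
  have hfin : ∀ s : Finset ℕ, ∑ k ∈ s, d k * ∑' j, Q k j * g j ≤ ρ * ∑' j, d j * g j := by
    intro s
    have e : ∑ k ∈ s, d k * ∑' j, Q k j * g j = ∑' j, ∑ k ∈ s, d k * (Q k j * g j) := by
      rw [Summable.tsum_finsetSum (fun k _ => (hs k).mul_left (d k))]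
      refine Finset.sum_congr rfl (fun k _ => (tsum_mul_left).symm)
    rw [e, ← tsum_mul_left]
    refine Summable.tsum_le_tsum ?_ (summable_sum fun k _ => (hs k).mul_left (d k)) (hg.mul_left ρ)
    intro j
    have h1 : ∑ k ∈ s, d k * Q k j ≤ ρ * d j :=
      ((hcol j).sum_le_tsum s
        (fun k _ => mul_nonneg (by linarith [hd k]) (hQ0 k j))).trans (hcolle j)
    calc ∑ k ∈ s, d k * (Q k j * g j) = (∑ k ∈ s, d k * Q k j) * g j := by
          rw [Finset.sum_mul]; exact Finset.sum_congr rfl (fun k _ => by ring)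
      _ ≤ (ρ * d j) * g j := mul_le_mul_of_nonneg_right h1 (hg0 j)
      _ = ρ * (d j * g j) := by ring
  have hnn : ∀ k, 0 ≤ d k * ∑' j, Q k j * g j := fun k =>
    mul_nonneg (by linarith [hd k]) (tsum_nonneg fun j => mul_nonneg (hQ0 k j) (hg0 j))
  exact ⟨hs, summable_of_sum_le hnn hfin, Real.tsum_le_of_sum_le hnn hfin⟩

lemma aux_deriv (g : ℕ → ℝ) (N : ℕ) (t : ℝ) :
    HasDerivAt (fun t : ℝ => ∑ n ∈ Finset.range (N + 1), t ^ n / (n.factorial : ℝ) * g n)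
      (∑ n ∈ Finset.range N, t ^ n / (n.factorial : ℝ) * g (n + 1)) t := by
  induction N with
  | zero => simpa using hasDerivAt_const t (g 0)
  | succ N ih =>
    have e : (fun t : ℝ => ∑ n ∈ Finset.range (N + 1 + 1), t ^ n / (n.factorial : ℝ) * g n)
        = fun t : ℝ => (∑ n ∈ Finset.range (N + 1), t ^ n / (n.factorial : ℝ) * g n)
          + t ^ (N+1) / ((N+1).factorial : ℝ) * g (N+1) := by
      funext t; rw [Finset.sum_range_succ]
    rw [e, Finset.sum_range_succ]
    refine ih.add ?_
    have := (((hasDerivAt_pow (N+1) t).div_const ((N+1).factorial : ℝ)).mul_const (g (N+1)))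
    refine this.congr_deriv ?_
    rw [Nat.factorial_succ]
    have : ((N.factorial : ℕ) : ℝ) ≠ 0 := by positivity
    push_cast
    field_simp

lemma aux_gron (d : ℕ → ℝ) (Q : ℕ → ℕ → ℝ) (ρ R M T : ℝ) (hd : ∀ k, 1 ≤ d k)
    (hT : 0 ≤ T)
    (hrow : ∀ k, Summable (fun j => |Q k j|))
    (hrowle : ∀ k, ∑' j, |Q k j| ≤ R)
    (hcol : ∀ j, Summable (fun k => d k * |Q k j|))
    (hcolle : ∀ j, ∑' k, d k * |Q k j| ≤ ρ * d j)
    (h : ℝ → ℕ → ℝ) (hM : ∀ t, 0 ≤ t → t ≤ T → ∀ k, |h t k| ≤ M)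
    (hder : ∀ t, 0 ≤ t → t ≤ T → ∀ k, HasDerivAt (fun s => h s k) (∑' j, Q k j * h t j) t)
    (h0 : Summable (fun k => d k * |h 0 k|)) :
    Summable (fun k => d k * |h T k|) ∧
    ∑' k, d k * |h T k| ≤ Real.exp (ρ * T) * ∑' k, d k * |h 0 k| := by
  have hd0 : ∀ k, 0 ≤ d k := fun k => by linarith [hd k]
  have hρ : 0 ≤ ρ := by
    have h1 : 0 ≤ ρ * d 0 :=
      (tsum_nonneg fun k => mul_nonneg (hd0 k) (abs_nonneg (Q k 0))).trans (hcolle 0)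
    by_contra hc
    push Not at hc
    nlinarith [hd 0]
  have hR : 0 ≤ R := (tsum_nonneg fun j => abs_nonneg (Q 0 j)).trans (hrowle 0)
  have hM0 : 0 ≤ M := (abs_nonneg _).trans (hM 0 le_rfl hT 0)
  let G : ℕ → ℕ → ℝ := fun n => Nat.rec (fun k => |h 0 k|) (fun _ g k => ∑' j, |Q k j| * g j) n
  have G0 : ∀ k, G 0 k = |h 0 k| := fun k => rfl
  have GS : ∀ n k, G (n+1) k = ∑' j, |Q k j| * G n j := fun n k => rfl
  have Gall : ∀ n, (∀ k, 0 ≤ G n k) ∧ Summable (fun k => d k * G n k) ∧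
      ∑' k, d k * G n k ≤ ρ ^ n * ∑' k, d k * |h 0 k| := by
    intro n
    induction n with
    | zero => exact ⟨fun k => abs_nonneg _, h0, by simp [G0]⟩
    | succ n ih =>
      obtain ⟨i1, i2, i3⟩ := ih
      obtain ⟨_, s2, s3⟩ := aux_step d (fun k j => |Q k j|) ρ hd (fun k j => abs_nonneg _)
        hrow hcol hcolle (G n) i1 i2
      refine ⟨fun k => tsum_nonneg fun j => mul_nonneg (abs_nonneg _) (i1 j), s2, s3.trans ?_⟩
      rw [pow_succ', mul_assoc]
      exact mul_le_mul_of_nonneg_left i3 hρ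
  have Gsum : ∀ n k, Summable (fun j => |Q k j| * G n j) := fun n =>
    (aux_step d (fun k j => |Q k j|) ρ hd (fun k j => abs_nonneg _)
        hrow hcol hcolle (G n) (Gall n).1 (Gall n).2.1).1
  have key : ∀ N, ∀ t, 0 ≤ t → t ≤ T → ∀ k, |h t k| ≤
      (∑ n ∈ Finset.range N, t ^ n / (n.factorial : ℝ) * G n k)
        + t ^ N / (N.factorial : ℝ) * (R ^ N * M) := by
    intro N
    induction N with
    | zero => intro t ht hT' k; simpa using hM t ht hT' k
    | succ N ih =>
      intro t ht htT k
      have hB : ∀ s : ℝ, HasDerivAt (fun t : ℝ =>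
          (∑ n ∈ Finset.range (N+1), t ^ n / (n.factorial : ℝ) * G n k)
          + t ^ (N+1) / ((N+1).factorial : ℝ) * (R ^ (N+1) * M))
          ((∑ n ∈ Finset.range N, s ^ n / (n.factorial : ℝ) * G (n+1) k)
          + s ^ N / (N.factorial : ℝ) * (R ^ (N+1) * M)) s := by
        intro s
        have := aux_deriv (fun n => if n = N + 1 then R ^ (N+1) * M else G n k) (N+1) s
        rw [Finset.sum_range_succ] at this
        convert this using 1
        · funext t
          rw [Finset.sum_range_succ _ (N+1)]
          congr 1
          · refine Finset.sum_congr rfl fun n hn => ?_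
            have : n ≠ N + 1 := by have := Finset.mem_range.1 hn; omega
            simp [this]
          · simp
        · congr 1
          · refine Finset.sum_congr rfl fun n hn => ?_
            have : n ≠ N := by have := Finset.mem_range.1 hn; omega
            simp [this]
          · simp
      have := image_norm_le_of_norm_deriv_right_le_deriv_boundary
        (f := fun s => h s k) (f' := fun s => ∑' j, Q k j * h s j) (a := 0) (b := t)
        (B := fun t : ℝ =>
          (∑ n ∈ Finset.range (N+1), t ^ n / (n.factorial : ℝ) * G n k)
          + t ^ (N+1) / ((N+1).factorial : ℝ) * (R ^ (N+1) * M))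
        (fun s hs => (hder s hs.1 (hs.2.trans htT) k).continuousAt.continuousWithinAt)
        (fun s hs => (hder s hs.1 (hs.2.le.trans htT) k).hasDerivWithinAt)
        (by
          rw [Finset.sum_range_succ']
          simp [G0]) hB
        (by
          intro s hs
          have hs0 := hs.1
          have hsT : s ≤ T := hs.2.le.trans htT
          have sm : Summable (fun j => |Q k j| *
              ((∑ n ∈ Finset.range N, s ^ n / (n.factorial : ℝ) * G n j)
              + s ^ N / (N.factorial : ℝ) * (R ^ N * M))) := by
            have : Summable (fun j => (∑ n ∈ Finset.range N, s ^ n / (n.factorial : ℝ) * (|Q k j| * G n j))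
              + |Q k j| * (s ^ N / (N.factorial : ℝ) * (R ^ N * M))) :=
              (summable_sum fun n _ => (Gsum n k).mul_left _).add ((hrow k).mul_right _)
            refine this.congr fun j => ?_
            rw [mul_add, Finset.mul_sum]
            congr 1
            exact Finset.sum_congr rfl fun n _ => by ring
          have le1 : ∀ j, ‖Q k j * h s j‖ ≤ |Q k j| *
              ((∑ n ∈ Finset.range N, s ^ n / (n.factorial : ℝ) * G n j)
              + s ^ N / (N.factorial : ℝ) * (R ^ N * M)) := by
            intro j
            rw [Real.norm_eq_abs, abs_mul]
            exact mul_le_mul_of_nonneg_left (ih s hs0 hsT j) (abs_nonneg _)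
          refine (tsum_of_norm_bounded sm.hasSum le1).trans ?_
          have e : (∑' j, |Q k j| *
              ((∑ n ∈ Finset.range N, s ^ n / (n.factorial : ℝ) * G n j)
              + s ^ N / (N.factorial : ℝ) * (R ^ N * M))) =
              (∑ n ∈ Finset.range N, s ^ n / (n.factorial : ℝ) * G (n+1) k)
              + (∑' j, |Q k j|) * (s ^ N / (N.factorial : ℝ) * (R ^ N * M)) := by
            rw [← tsum_mul_right]
            simp_rw [GS, ← tsum_mul_left]
            rw [← Summable.tsum_finsetSum (fun n _ => (Gsum n k).mul_left _),
              ← Summable.tsum_add (summable_sum fun n _ => (Gsum n k).mul_left _)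
                ((hrow k).mul_right _)]
            refine tsum_congr fun j => ?_
            rw [mul_add, Finset.mul_sum]
            congr 1
            exact Finset.sum_congr rfl fun n _ => by ring
          rw [e]
          have : (∑' j, |Q k j|) * (s ^ N / (N.factorial : ℝ) * (R ^ N * M)) ≤
              R * (s ^ N / (N.factorial : ℝ) * (R ^ N * M)) :=
            mul_le_mul_of_nonneg_right (hrowle k) (by positivity)
          have e2 : R * (s ^ N / (N.factorial : ℝ) * (R ^ N * M)) =
            s ^ N / (N.factorial : ℝ) * (R ^ (N+1) * M) := by ring
          linarith)
        (Set.right_mem_Icc.2 ht)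
      exact this
  have hfin : ∀ s : Finset ℕ, ∑ k ∈ s, d k * |h T k| ≤
      Real.exp (ρ * T) * ∑' k, d k * |h 0 k| := by
    intro s
    have hN : ∀ N : ℕ, ∑ k ∈ s, d k * |h T k| ≤ Real.exp (ρ * T) * (∑' k, d k * |h 0 k|) +
        (R * T) ^ N / (N.factorial : ℝ) * (M * ∑ k ∈ s, d k) := by
      intro N
      have b1 : ∀ n, ∑ k ∈ s, d k * G n k ≤ ρ ^ n * ∑' k, d k * |h 0 k| := fun n =>
        ((Gall n).2.1.sum_le_tsum s
          (fun k _ => mul_nonneg (hd0 k) ((Gall n).1 k))).trans (Gall n).2.2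
      have hN0 : 0 ≤ ∑' k, d k * |h 0 k| :=
        tsum_nonneg fun k => mul_nonneg (hd0 k) (abs_nonneg _)
      calc ∑ k ∈ s, d k * |h T k| ≤ ∑ k ∈ s, d k *
            ((∑ n ∈ Finset.range N, T ^ n / (n.factorial : ℝ) * G n k)
              + T ^ N / (N.factorial : ℝ) * (R ^ N * M)) :=
            Finset.sum_le_sum fun k _ => mul_le_mul_of_nonneg_left (key N T hT le_rfl k) (hd0 k)
        _ = (∑ n ∈ Finset.range N, T ^ n / (n.factorial : ℝ) * ∑ k ∈ s, d k * G n k) +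
            (R * T) ^ N / (N.factorial : ℝ) * (M * ∑ k ∈ s, d k) := by
            simp_rw [mul_add, Finset.sum_add_distrib, Finset.mul_sum]
            congr 1
            · rw [Finset.sum_comm]
              exact Finset.sum_congr rfl fun n _ => Finset.sum_congr rfl fun k _ => by ring
            · exact Finset.sum_congr rfl fun n _ => by rw [mul_pow]; ring
        _ ≤ (∑ n ∈ Finset.range N, T ^ n / (n.factorial : ℝ) * (ρ ^ n * ∑' k, d k * |h 0 k|)) +
            (R * T) ^ N / (N.factorial : ℝ) * (M * ∑ k ∈ s, d k) := by
            gcongr with n _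
            exact b1 n
        _ = (∑ n ∈ Finset.range N, (ρ * T) ^ n / (n.factorial : ℝ)) * (∑' k, d k * |h 0 k|) +
            (R * T) ^ N / (N.factorial : ℝ) * (M * ∑ k ∈ s, d k) := by
            rw [Finset.sum_mul]
            congr 1
            exact Finset.sum_congr rfl fun n _ => by rw [mul_pow]; ring
        _ ≤ _ := by
            gcongr
            exact Real.sum_le_exp_of_nonneg (mul_nonneg hρ hT) N
    have lim : Tendsto (fun N : ℕ => Real.exp (ρ * T) * (∑' k, d k * |h 0 k|) +
        (R * T) ^ N / (N.factorial : ℝ) * (M * ∑ k ∈ s, d k)) atTop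
        (𝓝 (Real.exp (ρ * T) * (∑' k, d k * |h 0 k|) + 0 * (M * ∑ k ∈ s, d k))) :=
      tendsto_const_nhds.add ((FloorSemiring.tendsto_pow_div_factorial_atTop (R * T)).mul_const _)
    have := ge_of_tendsto' lim hN
    simpa using this
  have hnn : ∀ k, 0 ≤ d k * |h T k| := fun k => mul_nonneg (hd0 k) (abs_nonneg _)
  exact ⟨summable_of_sum_le hnn hfin, Real.tsum_le_of_sum_le hnn hfin⟩

lemma aux_a_part (a : ℕ → ℕ → ℝ) (L : ℝ)
    (haoff : ∀ i j, i ≠ j → 0 ≤ a i j)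
    (hadiag : ∀ j, HasSum (fun i => a i j) 0)
    (haL : ∀ j, |a j j| ≤ L) (j k : ℕ) :
    ∑ i ∈ Finset.range k, |a i j| ≤ 2 * L := by
  have hL := haL j
  have h1 : ∀ i, |a i j| ≤ a i j + (if i = j then 2 * L else 0) := by
    intro i
    by_cases h : i = j
    · subst h
      have := neg_abs_le (a i i)
      simp only [if_true]
      linarith
    · simp [h, abs_of_nonneg (haoff i j h)]
  have h2 : HasSum (fun i => a i j + (if i = j then 2 * L else 0)) (0 + 2 * L) :=
    (hadiag j).add (hasSum_ite_eq j (2 * L))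
  calc ∑ i ∈ Finset.range k, |a i j|
      ≤ ∑ i ∈ Finset.range k, (a i j + (if i = j then 2 * L else 0)) :=
        Finset.sum_le_sum fun i _ => h1 i
    _ ≤ 0 + 2 * L := sum_le_hasSum _ (fun i _ => (abs_nonneg _).trans (h1 i)) h2
    _ = 2 * L := by ring

lemma aux_summ (a p : ℕ → ℝ) (K : ℝ) (ha : ∀ j, |a j| ≤ K) (hp : ∀ j, 0 ≤ p j)
    (hs : HasSum p 1) : Summable (fun j => a j * p j) ∧ |∑' j, a j * p j| ≤ K := by
  have h1 : ∀ j, ‖a j * p j‖ ≤ K * p j := by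
    intro j
    rw [Real.norm_eq_abs, abs_mul, abs_of_nonneg (hp j)]
    exact mul_le_mul_of_nonneg_right (ha j) (hp j)
  have h2 : HasSum (fun j => K * p j) K := by simpa using hs.mul_left K
  exact ⟨Summable.of_norm_bounded h2.summable h1, tsum_of_norm_bounded h2 h1⟩

lemma aux_cont (a : ℕ → ℕ → ℝ) (p : ℝ → ℕ → ℝ) (K : ℝ) (ha : ∀ i j, |a i j| ≤ K)
    (hp : IsKolmogorovSolution a p) (i : ℕ) : ContinuousOn (fun t => p t i) (Set.Ici 0) := by
  have hK : 0 ≤ K := (abs_nonneg _).trans (ha 0 0)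
  have key : ∀ s t, 0 ≤ s → s ≤ t → |p t i - p s i| ≤ K * |t - s| := by
    intro s t hs hst
    rw [hp.2 i s t hs hst, add_sub_cancel_left]
    rw [← Real.norm_eq_abs]
    refine intervalIntegral.norm_integral_le_of_norm_le_const (E := ℝ) fun u hu => ?_
    rw [Set.uIoc_of_le hst] at hu
    have hu0 : 0 ≤ u := hs.trans hu.1.le
    exact (aux_summ (a i) (p u) K (ha i) (hp.1 u hu0).1 (hp.1 u hu0).2).2
  refine LipschitzOnWith.continuousOn (K := K.toNNReal) ?_
  refine LipschitzOnWith.of_dist_le_mul fun s hs t ht => ?_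
  rw [Real.coe_toNNReal K hK, Real.dist_eq, Real.dist_eq]
  rcases le_total s t with h | h
  · rw [abs_sub_comm, abs_sub_comm s t]; exact key s t hs h
  · exact key t s ht h

lemma aux_int (a : ℕ → ℕ → ℝ) (p : ℝ → ℕ → ℝ) (K : ℝ) (ha : ∀ i j, |a i j| ≤ K)
    (hp : IsKolmogorovSolution a p) (i : ℕ) (t : ℝ) (ht : 0 ≤ t) :
    IntervalIntegrable (fun u => ∑' j, a i j * p u j) volume 0 t := by
  rw [intervalIntegrable_iff_integrableOn_Ioc_of_le ht]
  have hae : ∀ᵐ u ∂(volume.restrict (Set.Ioc 0 t)), 0 ≤ u :=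
    (ae_restrict_mem measurableSet_Ioc).mono fun u hu => hu.1.le
  refine Integrable.of_bound (C := K) ?_ ?_
  · refine aestronglyMeasurable_of_tendsto_ae atTop
      (f := fun (n : ℕ) u => ∑ j ∈ Finset.range n, a i j * p u j) ?_ ?_
    · intro n
      refine ContinuousOn.aestronglyMeasurable ?_ measurableSet_Ioc
      refine continuousOn_finsetSum _ fun j _ => continuousOn_const.mul ?_
      exact (aux_cont a p K ha hp j).mono fun u hu => hu.1.le
    · filter_upwards [hae] with u hu
      exact (aux_summ (a i) (p u) K (ha i) (hp.1 u hu).1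
        (hp.1 u hu).2).1.hasSum.tendsto_sum_nat
  · filter_upwards [hae] with u hu
    exact (aux_summ (a i) (p u) K (ha i) (hp.1 u hu).1 (hp.1 u hu).2).2

/-- The reduced tail matrix. -/
def auxC (a : ℕ → ℕ → ℝ) (k j : ℕ) : ℝ :=
  -(∑ i ∈ Finset.range (k + 1), a i (j + 1)) + ∑ i ∈ Finset.range (k + 1), a i j

lemma aux_abel (A w : ℕ → ℝ) (n : ℕ) :
    ∑ j ∈ Finset.range n, A j * w j =
      (∑ j ∈ Finset.range n, (A (j + 1) - A j) * (-∑ i ∈ Finset.range (j + 1), w i))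
        + A n * ∑ i ∈ Finset.range n, w i := by
  induction n with
  | zero => simp
  | succ n ih =>
    rw [Finset.sum_range_succ, ih, Finset.sum_range_succ _ n, Finset.sum_range_succ w n]
    ring

lemma aux_rhs (a : ℕ → ℕ → ℝ) (K : ℝ) (ha : ∀ j k, ∑ i ∈ Finset.range k, |a i j| ≤ K)
    (hC : ∀ k, Summable (fun j => |auxC a k j|))
    (q₁ q₂ : ℕ → ℝ) (h1 : ∀ i, 0 ≤ q₁ i) (h2 : ∀ i, 0 ≤ q₂ i) (s1 : HasSum q₁ 1)
    (s2 : HasSum q₂ 1) (k : ℕ) :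
    ∑' j, auxC a k j * (-∑ i ∈ Finset.range (j + 1), (q₁ i - q₂ i)) =
      -∑ i ∈ Finset.range (k + 1), ((∑' j, a i j * q₁ j) - ∑' j, a i j * q₂ j) := by
  have haK : ∀ i j, |a i j| ≤ K := fun i j =>
    (Finset.single_le_sum (f := fun i => |a i j|) (fun _ _ => abs_nonneg _)
      (Finset.self_mem_range_succ i)).trans (ha j (i + 1))
  have ws : HasSum (fun i => q₁ i - q₂ i) 0 := by simpa using s1.sub s2
  have wt := ws.tendsto_sum_nat
  have hb : ∃ B, ∀ n, |∑ i ∈ Finset.range n, (q₁ i - q₂ i)| ≤ B := by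
    obtain ⟨B, hB⟩ := (Metric.isBounded_range_of_tendsto _ wt).exists_norm_le
    exact ⟨B, fun n => hB _ ⟨n, rfl⟩⟩
  obtain ⟨B, hB⟩ := hb
  have sC : Summable (fun j => auxC a k j * (-∑ i ∈ Finset.range (j + 1), (q₁ i - q₂ i))) := by
    refine Summable.of_norm_bounded ((hC k).mul_right B) fun j => ?_
    rw [norm_mul, norm_neg, Real.norm_eq_abs]
    exact mul_le_mul_of_nonneg_left (hB _) (abs_nonneg _)
  let A : ℕ → ℝ := fun j => -∑ i ∈ Finset.range (k + 1), a i j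
  have hA : ∀ j, |A j| ≤ K := fun j => by
    simp only [A, abs_neg]
    exact (Finset.abs_sum_le_sum_abs _ _).trans (ha j _)
  have t1 : Tendsto (fun n => ∑ j ∈ Finset.range n, A j * (q₁ j - q₂ j)) atTop
      (𝓝 (∑' j, auxC a k j * (-∑ i ∈ Finset.range (j + 1), (q₁ i - q₂ i)) + 0)) := by
    simp_rw [aux_abel A (fun j => q₁ j - q₂ j)]
    refine Tendsto.add ?_ ?_
    · refine sC.hasSum.tendsto_sum_nat.congr fun n => ?_
      refine Finset.sum_congr rfl fun j _ => ?_
      simp only [A, auxC]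
      ring
    · refine squeeze_zero_norm (a := fun n => K * |∑ i ∈ Finset.range n, (q₁ i - q₂ i)|) ?_ ?_
      · intro n
        rw [norm_mul]
        exact mul_le_mul_of_nonneg_right (hA n) (abs_nonneg _)
      · simpa using (wt.abs.const_mul K)
  have t2 : HasSum (fun j => A j * (q₁ j - q₂ j))
      (-∑ i ∈ Finset.range (k + 1), ((∑' j, a i j * q₁ j) - ∑' j, a i j * q₂ j)) := by
    have := (hasSum_sum (s := Finset.range (k+1)) fun i _ =>
      (aux_summ (a i) q₁ K (haK i) h1 s1).1.hasSum.sub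
        (aux_summ (a i) q₂ K (haK i) h2 s2).1.hasSum).neg
    suffices e : (fun j => A j * (q₁ j - q₂ j)) = fun b =>
        -∑ i ∈ Finset.range (k + 1), (a i b * q₁ b - a i b * q₂ b) by
      rw [e]; exact this
    funext j
    simp only [A, neg_mul, Finset.sum_mul]
    congr 1
    exact Finset.sum_congr rfl fun i _ => by ring
  have := tendsto_nhds_unique t1 t2.tendsto_sum_nat
  simpa using this

lemma aux_X (a : ℕ → ℕ → ℝ) (K : ℝ) (ha : ∀ j k, ∑ i ∈ Finset.range k, |a i j| ≤ K)
    (hC : ∀ k, Summable (fun j => |auxC a k j|))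
    (p₁ p₂ : ℝ → ℕ → ℝ) (h1 : IsKolmogorovSolution a p₁) (h2 : IsKolmogorovSolution a p₂) :
    ∃ X : ℝ → ℕ → ℝ,
      (∀ t, 0 ≤ t → ∀ k, X t k = -∑ i ∈ Finset.range (k + 1), (p₁ t i - p₂ t i)) ∧
      (∀ t, 0 ≤ t → ∀ k, |X t k| ≤ 1) ∧
      (∀ t, 0 ≤ t → ∀ k, HasDerivAt (fun s => X s k) (∑' j, auxC a k j * X t j) t) := by
  have haK : ∀ i j, |a i j| ≤ K := fun i j =>
    (Finset.single_le_sum (f := fun i => |a i j|) (fun _ _ => abs_nonneg _)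
      (Finset.self_mem_range_succ i)).trans (ha j (i + 1))
  let x : ℝ → ℕ → ℝ := fun t k => -∑ i ∈ Finset.range (k + 1), (p₁ t i - p₂ t i)
  have hx1 : ∀ t, 0 ≤ t → ∀ k, |x t k| ≤ 1 := by
    intro t ht k
    obtain ⟨a1, b1⟩ := h1.1 t ht
    obtain ⟨a2, b2⟩ := h2.1 t ht
    have c1 := sum_le_hasSum (Finset.range (k+1)) (fun i _ => a1 i) b1
    have c2 := sum_le_hasSum (Finset.range (k+1)) (fun i _ => a2 i) b2
    have e1 : 0 ≤ ∑ i ∈ Finset.range (k+1), p₁ t i := Finset.sum_nonneg fun i _ => a1 i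
    have e2 : 0 ≤ ∑ i ∈ Finset.range (k+1), p₂ t i := Finset.sum_nonneg fun i _ => a2 i
    simp only [x, Finset.sum_sub_distrib]
    rw [abs_le]
    constructor <;> linarith
  have hxc : ∀ k, Continuous (fun t => x (max t 0) k) := by
    intro k
    have : ContinuousOn (fun t => x t k) (Set.Ici 0) :=
      (continuousOn_finsetSum _ fun i _ =>
        (aux_cont a p₁ K haK h1 i).sub (aux_cont a p₂ K haK h2 i)).neg
    exact this.comp_continuous (by fun_prop) (fun t => le_max_right t 0)
  let F : ℕ → ℝ → ℝ := fun k t => ∑' j, auxC a k j * x (max t 0) j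
  have hF : ∀ k, Continuous (F k) := by
    intro k
    refine continuous_tsum (u := fun j => |auxC a k j|) (fun j => continuous_const.mul (hxc j))
      (hC k) fun j t => ?_
    rw [norm_mul]
    exact mul_le_of_le_one_right (abs_nonneg _) (hx1 _ (le_max_right t 0) j)
  have hX : ∀ t, 0 ≤ t → ∀ k, x 0 k + ∫ u in (0:ℝ)..t, F k u = x t k := by
    intro t ht k
    have e : ∫ u in (0:ℝ)..t, F k u = ∫ u in (0:ℝ)..t,
        -∑ i ∈ Finset.range (k + 1), ((∑' j, a i j * p₁ u j) - ∑' j, a i j * p₂ u j) := by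
      refine integral_congr fun u hu => ?_
      rw [Set.uIcc_of_le ht] at hu
      simp only [F, x, max_eq_left hu.1]
      exact aux_rhs a K ha hC (p₁ u) (p₂ u) (h1.1 u hu.1).1 (h2.1 u hu.1).1
        (h1.1 u hu.1).2 (h2.1 u hu.1).2 k
    rw [e, intervalIntegral.integral_neg, intervalIntegral.integral_finsetSum (fun i _ =>
      (aux_int a p₁ K haK h1 i t ht).sub (aux_int a p₂ K haK h2 i t ht))]
    simp only [x]
    rw [← neg_add, ← Finset.sum_add_distrib]
    congr 1
    refine Finset.sum_congr rfl fun i _ => ?_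
    rw [intervalIntegral.integral_sub (aux_int a p₁ K haK h1 i t ht)
      (aux_int a p₂ K haK h2 i t ht), h1.2 i 0 t le_rfl ht, h2.2 i 0 t le_rfl ht]
    ring
  refine ⟨fun t k => x 0 k + ∫ u in (0:ℝ)..t, F k u, fun t ht k => hX t ht k,
    fun t ht k => by
      change |x 0 k + ∫ u in (0:ℝ)..t, F k u| ≤ 1
      rw [hX t ht k]; exact hx1 t ht k, fun t ht k => ?_⟩
  have : HasDerivAt (fun s => x 0 k + ∫ u in (0:ℝ)..s, F k u) (F k t) t :=
    (integral_hasDerivAt_right ((hF k).intervalIntegrable _ _)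
      ((hF k).stronglyMeasurableAtFilter _ _) (hF k).continuousAt).const_add _
  refine this.congr_deriv ?_
  simp only [F, max_eq_left ht]
  exact tsum_congr fun j => by rw [hX t ht j]

lemma aux_bstar (a : ℕ → ℕ → ℝ) (d : ℕ → ℝ) (hadiag : ∀ j, HasSum (fun i => a i j) 0)
    (k j : ℕ) : bStar d a (k + 1) (j + 1) = d (k + 1) / d (j + 1) * auxC a k j := by
  unfold bStar
  congr 1
  have ht : ∀ j, HasSum (fun m => a (k + 1 + m) j) (-∑ i ∈ Finset.range (k + 1), a i j) := by
    intro j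
    have := (hasSum_nat_add_iff (f := fun i => a i j) (k + 1)
      (g := -∑ i ∈ Finset.range (k + 1), a i j)).2 (by simpa using hadiag j)
    simpa [add_comm, add_left_comm, add_assoc] using this
  have h := (ht (j + 1)).sub (ht j)
  rw [← tsum_congr (f := fun m => a (k + 1 + m) (j + 1) - a (k + 1 + m) j), h.tsum_eq]
  · simp only [auxC]; ring
  · intro m
    rcases j with _ | j
    · simp [bEntry]
    · simp [bEntry]

lemma aux_tail (w : ℕ → ℝ) (hw : HasSum w 0) (k : ℕ) :
    ∑' i, w (k + 1 + i) = -∑ i ∈ Finset.range (k + 1), w i := by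
  have := (hasSum_nat_add_iff (f := w) (k + 1)
    (g := -∑ i ∈ Finset.range (k + 1), w i)).2 (by simpa using hw)
  rw [← this.tsum_eq]
  exact tsum_congr fun i => by rw [add_comm]

lemma aux_l1 (d w : ℕ → ℝ) (hd : ∀ k, 1 ≤ d k)
    (h : Summable fun k => d k * |-∑ i ∈ Finset.range (k + 1), w i|) :
    ∑' k, |w k| ≤ 2 * ∑' k, d k * |-∑ i ∈ Finset.range (k + 1), w i| := by
  refine Real.tsum_le_of_sum_range_le (fun _ => abs_nonneg _) fun n => ?_
  set y : ℕ → ℝ := fun k => d k * |-∑ i ∈ Finset.range (k + 1), w i| with hy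
  have hb : ∀ k, |∑ i ∈ Finset.range (k + 1), w i| ≤ y k := by
    intro k
    simp only [hy, abs_neg]
    exact le_mul_of_one_le_left (abs_nonneg _) (hd k)
  have y0 : ∀ k, 0 ≤ y k := fun k => (abs_nonneg _).trans (hb k)
  have hpart : ∀ n, ∑ k ∈ Finset.range n, y k ≤ ∑' k, y k := fun n =>
    h.sum_le_tsum _ fun k _ => y0 k
  have key : ∀ n, ∑ k ∈ Finset.range (n + 1), |w k| ≤
      (∑ k ∈ Finset.range (n + 1), y k) + ∑ k ∈ Finset.range n, y k := by
    intro n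
    induction n with
    | zero => simpa using hb 0
    | succ n ih =>
      rw [Finset.sum_range_succ, Finset.sum_range_succ y (n + 1), Finset.sum_range_succ y n]
      rw [Finset.sum_range_succ y n] at ih
      have e : w (n + 1) = (∑ i ∈ Finset.range (n + 1 + 1), w i)
          - ∑ i ∈ Finset.range (n + 1), w i := by
        rw [Finset.sum_range_succ w (n + 1)]; ring
      have h1 : |w (n + 1)| ≤ y (n + 1) + y n := by
        rw [e]
        exact (abs_sub _ _).trans (add_le_add (hb (n + 1)) (hb n))
      linarith
  rcases n with _ | n
  · simpa using tsum_nonneg y0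
  · linarith [key n, hpart (n + 1), hpart n]

lemma aux_rowC (a : ℕ → ℕ → ℝ) (K : ℝ) (ha : ∀ j k, ∑ i ∈ Finset.range k, |a i j| ≤ K)
    (hoff : ∀ k j, k ≠ j → 0 ≤ auxC a k j) :
    (∀ k j, |auxC a k j| ≤ 2 * K) ∧ (∀ k, Summable fun j => |auxC a k j|) ∧
    (∀ k, ∑' j, |auxC a k j| ≤ 6 * K) := by
  have hA : ∀ k j, |∑ i ∈ Finset.range k, a i j| ≤ K := fun k j =>
    (Finset.abs_sum_le_sum_abs _ _).trans (ha j k)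
  have hb : ∀ k j, |auxC a k j| ≤ 2 * K := by
    intro k j
    have h1 := abs_le.1 (hA (k + 1) j)
    have h2 := abs_le.1 (hA (k + 1) (j + 1))
    unfold auxC
    rw [abs_le]
    constructor <;> linarith [h1.1, h1.2, h2.1, h2.2]
  have hK : 0 ≤ K := (abs_nonneg _).trans (hA 0 0)
  have hp : ∀ k n, ∑ j ∈ Finset.range n, |auxC a k j| ≤ 6 * K := by
    intro k n
    have h1 : ∀ j, |auxC a k j| ≤ auxC a k j + (if j = k then 4 * K else 0) := by
      intro j
      by_cases h : j = k
      · have h1 := abs_le.1 (hb k j)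
        have h2 := hb k j
        simp only [h, if_true] at *
        linarith [h1.1]
      · simp [h, abs_of_nonneg (hoff k j (Ne.symm h))]
    have h2 : ∑ j ∈ Finset.range n, auxC a k j =
        (∑ i ∈ Finset.range (k + 1), a i 0) - ∑ i ∈ Finset.range (k + 1), a i n := by
      rw [← Finset.sum_range_sub' (fun j => ∑ i ∈ Finset.range (k + 1), a i j)]
      exact Finset.sum_congr rfl fun j _ => by unfold auxC; ring
    have h3 : ∑ j ∈ Finset.range n, (if j = k then 4 * K else 0) ≤ 4 * K := by
      rw [Finset.sum_ite_eq']
      split_ifs <;> linarith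
    have h4 := Finset.sum_le_sum fun j (_ : j ∈ Finset.range n) => h1 j
    rw [Finset.sum_add_distrib, h2] at h4
    linarith [(abs_le.1 (hA (k + 1) 0)).2, (abs_le.1 (hA (k + 1) n)).1]
  exact ⟨hb, fun k => summable_of_sum_range_le (fun _ => abs_nonneg _) (hp k),
    fun k => Real.tsum_le_of_sum_range_le (fun _ => abs_nonneg _) (hp k)⟩

lemma aux_main
    (a : ℕ → ℕ → ℝ) (d : ℕ → ℝ) (L : ℝ)
    (hd1 : d 1 = 1) (hdpos : ∀ k, 1 ≤ k → 0 < d k)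
    (hdmono : ∀ k, 1 ≤ k → d k ≤ d (k + 1))
    (haoff : ∀ i j, i ≠ j → 0 ≤ a i j)
    (hadiag : ∀ j, HasSum (fun i => a i j) 0)
    (haL : ∀ j, |a j j| ≤ L)
    (hbstar : ∀ i j, 1 ≤ i → 1 ≤ j → i ≠ j → 0 ≤ bStar d a i j)
    (α : ℝ) (hα : α = ⨅ i : ℕ, alphaI d a (i + 1))
    (χ : ℝ) (hχ : χ = ⨆ i : ℕ, ∑' j : ℕ, |bStar d a (j + 1) (i + 1)|)
    (hχfin : (∀ i : ℕ, Summable (fun j : ℕ => |bStar d a (j + 1) (i + 1)|)) ∧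
      BddAbove (Set.range fun i : ℕ => ∑' j : ℕ, |bStar d a (j + 1) (i + 1)|))
    (p₁ p₂ : ℝ → ℕ → ℝ) (h1 : IsKolmogorovSolution a p₁) (h2 : IsKolmogorovSolution a p₂)
    (hfin : Norm1DFinite d (fun k => p₁ 0 k - p₂ 0 k)) (t : ℝ) (ht : 0 ≤ t) :
        Real.exp (-χ * t) * norm1D d (fun k => p₁ 0 k - p₂ 0 k) ≤
            norm1D d (fun k => p₁ t k - p₂ t k) ∧
        norm1D d (fun k => p₁ t k - p₂ t k) ≤
            Real.exp (-α * t) * norm1D d (fun k => p₁ 0 k - p₂ 0 k) ∧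
        (∑' k : ℕ, |p₁ t k - p₂ t k|) ≤
            2 * norm1D d (fun k => p₁ t k - p₂ t k) := by
  obtain ⟨hχs, hχb⟩ := hχfin
  let D : ℕ → ℝ := fun k => d (k + 1)
  have hD : ∀ k, 1 ≤ D k := by
    intro k
    induction k with
    | zero => exact hd1.ge
    | succ k ih => exact ih.trans (hdmono (k + 1) (by omega))
  have hDp : ∀ k, 0 < D k := fun k => by linarith [hD k]
  have hbs : ∀ k j, D k * auxC a k j = bStar d a (k + 1) (j + 1) * D j := by
    intro k j
    rw [aux_bstar a d hadiag]
    have := (hDp j).ne'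
    simp only [D] at *
    field_simp
  have hbsabs : ∀ k j, D k * |auxC a k j| = |bStar d a (k + 1) (j + 1)| * D j := by
    intro k j
    have := congrArg abs (hbs k j)
    rwa [abs_mul, abs_mul, abs_of_pos (hDp k), abs_of_pos (hDp j)] at this
  have hoff : ∀ k j, k ≠ j → 0 ≤ auxC a k j := by
    intro k j hkj
    have h3 := hbstar (k + 1) (j + 1) (by omega) (by omega) (by omega)
    have h4 : 0 ≤ D k * auxC a k j := by rw [hbs]; exact mul_nonneg h3 (hDp j).le
    exact nonneg_of_mul_nonneg_right h4 (hDp k)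
  let K := 2 * L
  have ha := aux_a_part a L haoff hadiag haL
  obtain ⟨hCb, hCs, hCr⟩ := aux_rowC a K ha hoff
  have hK : 0 ≤ K := by linarith [(abs_nonneg _).trans (hCb 0 0)]
  obtain ⟨X, hX, hX1, hXd⟩ := aux_X a K ha hCs p₁ p₂ h1 h2
  have hw : ∀ s, 0 ≤ s → HasSum (fun k => p₁ s k - p₂ s k) 0 := fun s hs => by
    simpa using (h1.1 s hs).2.sub (h2.1 s hs).2
  have htail : ∀ s, 0 ≤ s → ∀ k, ∑' i, (p₁ s (k + 1 + i) - p₂ s (k + 1 + i)) = X s k := by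
    intro s hs k
    rw [hX s hs k]
    exact aux_tail _ (hw s hs) k
  have hnorm : ∀ s, 0 ≤ s → norm1D d (fun k => p₁ s k - p₂ s k) = ∑' k, D k * |X s k| := by
    intro s hs
    unfold norm1D
    exact tsum_congr fun k => by rw [htail s hs k]
  have hfin0 : Summable fun k => D k * |X 0 k| := by
    refine hfin.congr fun k => ?_
    rw [htail 0 le_rfl k]
  have hχle : ∀ i, ∑' j : ℕ, |bStar d a (j + 1) (i + 1)| ≤ χ := fun i => by
    rw [hχ]; exact le_ciSup hχb i
  have hαle : ∀ i, ∑' j : ℕ, bStar d a (j + 1) (i + 1) ≤ -α := by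
    intro i
    have hbd : BddBelow (Set.range fun i : ℕ => alphaI d a (i + 1)) := by
      refine ⟨-χ, ?_⟩
      rintro _ ⟨i, rfl⟩
      simp only [alphaI]
      have : ∑' j : ℕ, bStar d a (j + 1) (i + 1) ≤ ∑' j : ℕ, |bStar d a (j + 1) (i + 1)| :=
        Summable.tsum_le_tsum (fun j => le_abs_self _) (hχs i).of_abs (hχs i)
      linarith [hχle i]
    have := ciInf_le hbd i
    rw [← hα] at this
    simp only [alphaI] at this
    linarith
  -- the shifted nonnegative matrix
  let P : ℕ → ℕ → ℝ := fun k j => auxC a k j + if j = k then 2 * K else 0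
  have hP0 : ∀ k j, 0 ≤ P k j := by
    intro k j
    by_cases h : j = k
    · simp only [P, h, if_true]
      linarith [(abs_le.1 (hCb k k)).1]
    · simp only [P, h, if_false, add_zero]
      exact hoff k j (Ne.symm h)
  have hPabs : ∀ k j, |P k j| = P k j := fun k j => abs_of_nonneg (hP0 k j)
  have hite : ∀ k : ℕ, HasSum (fun j : ℕ => if j = k then 2 * K else 0) (2 * K) := fun k =>
    hasSum_ite_eq k (2 * K)
  have hPcol : ∀ j, HasSum (fun k => D k * |P k j|)
      ((∑' k : ℕ, bStar d a (k + 1) (j + 1)) * D j + 2 * K * D j) := by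
    intro j
    have e := ((hχs j).of_abs.hasSum.mul_right (D j)).add (hasSum_ite_eq j (2 * K * D j))
    suffices h : (fun k => D k * |P k j|) = fun k =>
        bStar d a (k + 1) (j + 1) * D j + if k = j then 2 * K * D j else 0 by
      rw [h]; exact e
    funext k
    rw [hPabs, ← hbs]
    simp only [P]
    by_cases h : j = k
    · simp only [h, if_true]; ring
    · simp only [h, Ne.symm h, if_false]; ring
  have up := aux_gron D P (2 * K - α) (8 * K) (Real.exp (2 * K * t)) t hD ht
    (fun k => by
      simp_rw [hPabs]
      exact (hCs k).of_abs.add (hite k).summable)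
    (fun k => by
      simp_rw [hPabs]
      simp only [P]
      rw [Summable.tsum_add (hCs k).of_abs (hite k).summable, (hite k).tsum_eq]
      have : ∑' j, auxC a k j ≤ ∑' j, |auxC a k j| :=
        Summable.tsum_le_tsum (fun j => le_abs_self _) (hCs k).of_abs (hCs k)
      linarith [hCr k])
    (fun j => (hPcol j).summable)
    (fun j => by
      rw [(hPcol j).tsum_eq]
      nlinarith [hαle j, hDp j])
    (fun s k => Real.exp (2 * K * s) * X s k)
    (fun s hs hst k => by
      rw [abs_mul, abs_of_pos (Real.exp_pos _)]
      calc Real.exp (2 * K * s) * |X s k| ≤ Real.exp (2 * K * s) * 1 :=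
            mul_le_mul_of_nonneg_left (hX1 s hs k) (Real.exp_pos _).le
        _ = Real.exp (2 * K * s) := mul_one _
        _ ≤ _ := Real.exp_le_exp.2 (mul_le_mul_of_nonneg_left hst (by linarith)))
    (fun s hs hst k => by
      have e1 : HasDerivAt (fun s : ℝ => Real.exp (2 * K * s))
          (Real.exp (2 * K * s) * (2 * K)) s := by
        have := ((hasDerivAt_id s).const_mul (2 * K)).exp
        simpa using this
      refine (e1.mul (hXd s hs k)).congr_deriv ?_
      have sx : Summable fun j => auxC a k j * X s j := by
        refine Summable.of_norm_bounded (hCs k) fun j => ?_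
        rw [norm_mul]
        exact mul_le_of_le_one_right (abs_nonneg _) (hX1 s hs j)
      have s2 : HasSum (fun j => if j = k then 2 * K * X s k else 0) (2 * K * X s k) :=
        hasSum_ite_eq k _
      have e2 := (sx.hasSum.add s2).mul_left (Real.exp (2 * K * s))
      have e3 : ∑' j, P k j * (Real.exp (2 * K * s) * X s j) = ∑' j, Real.exp (2 * K * s) *
          (auxC a k j * X s j + if j = k then 2 * K * X s k else 0) := by
        refine tsum_congr fun j => ?_
        simp only [P]
        by_cases h : j = k
        · simp only [h, if_true]; ring
        · simp only [h, if_false]; ring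
      rw [e3, e2.tsum_eq]
      ring)
    (by simpa using hfin0)
  have expo : ∀ s k, D k * |Real.exp (2 * K * s) * X s k| =
      Real.exp (2 * K * s) * (D k * |X s k|) := fun s k => by
    rw [abs_mul, abs_of_pos (Real.exp_pos _)]; ring
  simp only [expo] at up
  obtain ⟨up1, up2⟩ := up
  have hfint : Summable fun k => D k * |X t k| :=
    (summable_mul_left_iff (Real.exp_pos _).ne').1 up1
  rw [tsum_mul_left, tsum_mul_left, mul_zero, Real.exp_zero, one_mul] at up2
  have upper : ∑' k, D k * |X t k| ≤ Real.exp (-α * t) * ∑' k, D k * |X 0 k| := by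
    have e : Real.exp ((2 * K - α) * t) = Real.exp (2 * K * t) * Real.exp (-α * t) := by
      rw [← Real.exp_add]; ring_nf
    rw [e, mul_assoc (Real.exp (2 * K * t))] at up2
    exact le_of_mul_le_mul_left up2 (Real.exp_pos _)
  have low := aux_gron D (fun k j => -auxC a k j) χ (6 * K) 1 t hD ht
    (fun k => by simpa using hCs k)
    (fun k => by simpa using hCr k)
    (fun j => by
      simp only [abs_neg, hbsabs]
      exact (hχs j).mul_right _)
    (fun j => by
      simp only [abs_neg, hbsabs]
      rw [tsum_mul_right]
      exact mul_le_mul_of_nonneg_right (hχle j) (hDp j).le)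
    (fun s k => X (t - s) k)
    (fun s hs hst k => hX1 (t - s) (by linarith) k)
    (fun s hs hst k => by
      have e1 := hXd (t - s) (by linarith) k
      have e2 : HasDerivAt (fun s : ℝ => t - s) (-1) s := by
        simpa using (hasDerivAt_id s).const_sub t
      refine (HasDerivAt.comp s e1 e2).congr_deriv ?_
      simp only [neg_mul]
      rw [tsum_neg]; ring)
    (by simpa using hfint)
  have low2 := low.2
  simp only [sub_self, sub_zero] at low2
  rw [hnorm 0 le_rfl, hnorm t ht]
  refine ⟨?_, upper, ?_⟩
  · calc Real.exp (-χ * t) * ∑' k, D k * |X 0 k|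
        ≤ Real.exp (-χ * t) * (Real.exp (χ * t) * ∑' k, D k * |X t k|) :=
          mul_le_mul_of_nonneg_left low2 (Real.exp_pos _).le
      _ = ∑' k, D k * |X t k| := by
          rw [← mul_assoc, ← Real.exp_add]; simp
  · have := aux_l1 D (fun k => p₁ t k - p₂ t k) hD (by
      simpa only [hX t ht] using hfint)
    simpa only [hX t ht] using this

/-- Theorem 2.  For a homogeneous chain with `α = inf_{i≥1} α_i > 0`
and `χ = sup_{i≥1} Σ_{j≥1} |b*_{ji}| < ∞`, any two solutions `p*`, `p**` of the forward
Kolmogorov system with `‖p*(0) − p**(0)‖_{1D} < ∞` satisfy, for all `t ≥ 0`,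
`e^{−χt}·‖p*(0) − p**(0)‖_{1D} ≤ ‖p*(t) − p**(t)‖_{1D} ≤ e^{−αt}·‖p*(0) − p**(0)‖_{1D}`
and `‖p*(t) − p**(t)‖ ≤ 4e^{−αt}·‖z*(0) − z**(0)‖_{1D}`.  In particular, any stationary
stochastic vector `π` with `‖z_π‖_{1D} < ∞` attracts every solution `p` with
`‖z(0) − z_π‖_{1D} < ∞` at rate `α`: `‖p(t) − π‖ ≤ 4e^{−αt}·‖z(0) − z_π‖_{1D}` (so the
decay parameter of the chain is at least `α`). -/
theorem thm2_homogeneous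
    (a : ℕ → ℕ → ℝ) (d : ℕ → ℝ) (L : ℝ)
    (hd1 : d 1 = 1) (hdpos : ∀ k, 1 ≤ k → 0 < d k)
    (hdmono : ∀ k, 1 ≤ k → d k ≤ d (k + 1))
    (haoff : ∀ i j, i ≠ j → 0 ≤ a i j)
    (hadiag : ∀ j, HasSum (fun i => a i j) 0)
    (haL : ∀ j, |a j j| ≤ L)
    (hbstar : ∀ i j, 1 ≤ i → 1 ≤ j → i ≠ j → 0 ≤ bStar d a i j)
    (α : ℝ) (hα : α = ⨅ i : ℕ, alphaI d a (i + 1)) (hαpos : 0 < α)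
    (χ : ℝ) (hχ : χ = ⨆ i : ℕ, ∑' j : ℕ, |bStar d a (j + 1) (i + 1)|)
    (hχfin : (∀ i : ℕ, Summable (fun j : ℕ => |bStar d a (j + 1) (i + 1)|)) ∧
      BddAbove (Set.range fun i : ℕ => ∑' j : ℕ, |bStar d a (j + 1) (i + 1)|)) :
    (∀ p₁ p₂ : ℝ → ℕ → ℝ, IsKolmogorovSolution a p₁ → IsKolmogorovSolution a p₂ →
      Norm1DFinite d (fun k => p₁ 0 k - p₂ 0 k) →
      ∀ t : ℝ, 0 ≤ t →
        Real.exp (-χ * t) * norm1D d (fun k => p₁ 0 k - p₂ 0 k) ≤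
            norm1D d (fun k => p₁ t k - p₂ t k) ∧
        norm1D d (fun k => p₁ t k - p₂ t k) ≤
            Real.exp (-α * t) * norm1D d (fun k => p₁ 0 k - p₂ 0 k) ∧
        (∑' k : ℕ, |p₁ t k - p₂ t k|) ≤
            4 * Real.exp (-α * t) * norm1D d (fun k => p₁ 0 k - p₂ 0 k)) ∧
    (∀ π : ℕ → ℝ, (∀ i, 0 ≤ π i) → HasSum π 1 →
      (∀ i, HasSum (fun j => a i j * π j) 0) → Norm1DFinite d π →
      ∀ p : ℝ → ℕ → ℝ, IsKolmogorovSolution a p →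
        Norm1DFinite d (fun k => p 0 k - π k) →
        ∀ t : ℝ, 0 ≤ t →
          (∑' k : ℕ, |p t k - π k|) ≤
            4 * Real.exp (-α * t) * norm1D d (fun k => p 0 k - π k)) := by
  constructor
  · intro p₁ p₂ h1 h2 hfin t ht
    obtain ⟨r1, r2, r3⟩ := aux_main a d L hd1 hdpos hdmono haoff hadiag haL hbstar α hα χ hχ hχfin
      p₁ p₂ h1 h2 hfin t ht
    refine ⟨r1, r2, ?_⟩
    have : 0 ≤ norm1D d (fun k => p₁ t k - p₂ t k) :=
      tsum_nonneg fun k => mul_nonneg (hdpos _ (by omega)).le (abs_nonneg _)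
    linarith
  · intro π hπ0 hπ1 hπs _ p hp hfin t ht
    have hsol : IsKolmogorovSolution a (fun _ => π) := by
      refine ⟨fun _ _ => ⟨hπ0, hπ1⟩, fun i s t _ _ => ?_⟩
      simp [(hπs i).tsum_eq]
    obtain ⟨r1, r2, r3⟩ := aux_main a d L hd1 hdpos hdmono haoff hadiag haL hbstar α hα χ hχ hχfin
      p (fun _ => π) hp hsol hfin t ht
    have : 0 ≤ norm1D d (fun k => p t k - π k) :=
      tsum_nonneg fun k => mul_nonneg (hdpos _ (by omega)).le (abs_nonneg _)
    linarith
end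
end

section
/- (Corollary 1, bound (cor001).) Assume the intensities are time-independent, the off-diagonal entries of D B D⁻¹ are nonnegative, and α = inf_i α_i > 0. Let π be a stationary stochastic vector (Σ_j a_{ij} π_j = 0 for every i), and let F = ‖f‖_{1D} = Σ_{k≥1} d_k Σ_{i≥k} a_{i0} < ∞, where f = (a_{10}, a_{20}, ...). Then ‖z_π‖_{1D} ≤ F/α, and the solution p of the forward Kolmogorov system with initial condition p(0) = e_0 (unit mass at state 0) satisfies ‖π − p(t)‖ ≤ (4F/α)·e^{−αt} for all t ≥ 0. -/
open MeasureTheory intervalIntegral Filter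
open scoped Topology

noncomputable section

/-- `T i j = -∑_{k<i} a k j`, equal to the column tail `∑_{k ≥ i} a k j`. -/
def colT (a : ℕ → ℕ → ℝ) (i j : ℕ) : ℝ := -∑ k ∈ Finset.range i, a k j

/-- zero-based differences -/
def diffS (a : ℕ → ℕ → ℝ) (i j : ℕ) : ℝ := colT a (i + 1) (j + 1) - colT a (i + 1) j

lemma sum_le_neg_diag (a : ℕ → ℕ → ℝ) (haoff : ∀ i j, i ≠ j → 0 ≤ a i j)
    (hadiag : ∀ j, HasSum (fun i => a i j) 0) (s : Finset ℕ) (j : ℕ) :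
    ∑ k ∈ s.erase j, a k j ≤ - a j j := by
  have h := sum_le_hasSum (insert j s) (fun i hi => haoff i j (by
    rintro rfl; simp at hi)) (hadiag j)
  rw [← Finset.insert_erase (Finset.mem_insert_self j s), Finset.sum_insert (by simp),
    Finset.erase_insert_eq_erase] at h
  linarith

lemma diag_nonpos (a : ℕ → ℕ → ℝ) (haoff : ∀ i j, i ≠ j → 0 ≤ a i j)
    (hadiag : ∀ j, HasSum (fun i => a i j) 0) (j : ℕ) : a j j ≤ 0 := by
  have := sum_le_neg_diag a haoff hadiag ∅ j
  simp at this; linarith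

lemma abs_colT_le (a : ℕ → ℕ → ℝ) (L : ℝ) (haoff : ∀ i j, i ≠ j → 0 ≤ a i j)
    (hadiag : ∀ j, HasSum (fun i => a i j) 0) (haL : ∀ j, |a j j| ≤ L) (i j : ℕ) :
    |colT a i j| ≤ L := by
  have h1 := sum_le_neg_diag a haoff hadiag (Finset.range i) j
  have h2 := diag_nonpos a haoff hadiag j
  have h3 : 0 ≤ ∑ k ∈ (Finset.range i).erase j, a k j :=
    Finset.sum_nonneg fun k hk => haoff k j (Finset.ne_of_mem_erase hk)
  have h4 := abs_le.1 (haL j)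
  unfold colT
  by_cases hj : j ∈ Finset.range i
  · rw [← Finset.add_sum_erase _ _ hj, abs_le]
    constructor <;> linarith
  · rw [Finset.erase_eq_of_notMem hj] at h1 h3
    rw [abs_le]; constructor <;> linarith

lemma abs_a_le (a : ℕ → ℕ → ℝ) (L : ℝ) (haoff : ∀ i j, i ≠ j → 0 ≤ a i j)
    (hadiag : ∀ j, HasSum (fun i => a i j) 0) (haL : ∀ j, |a j j| ≤ L) (i j : ℕ) :
    |a i j| ≤ L := by
  by_cases hij : i = j
  · subst hij; exact haL i
  · have h1 := sum_le_neg_diag a haoff hadiag {i} j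
    rw [Finset.erase_eq_of_notMem (by simpa using fun h => hij h.symm)] at h1
    simp at h1
    rw [abs_of_nonneg (haoff i j hij)]
    have := abs_le.1 (haL j)
    linarith

lemma hasSum_colT (a : ℕ → ℕ → ℝ) (hadiag : ∀ j, HasSum (fun i => a i j) 0) (i j : ℕ) :
    HasSum (fun k => a (i + k) j) (colT a i j) := by
  have := (hasSum_nat_add_iff' i).2 (hadiag j)
  simpa [colT, add_comm] using this

lemma colT_nonneg (a : ℕ → ℕ → ℝ) (haoff : ∀ i j, i ≠ j → 0 ≤ a i j)
    (hadiag : ∀ j, HasSum (fun i => a i j) 0) (i j : ℕ) (h : j < i) : 0 ≤ colT a i j :=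
  (hasSum_colT a hadiag i j).nonneg fun k => haoff _ _ (by omega)

lemma colT_nonpos (a : ℕ → ℕ → ℝ) (haoff : ∀ i j, i ≠ j → 0 ≤ a i j)
    (i j : ℕ) (h : i ≤ j) : colT a i j ≤ 0 := by
  unfold colT
  have : 0 ≤ ∑ k ∈ Finset.range i, a k j := Finset.sum_nonneg fun k hk =>
    haoff _ _ (by have := Finset.mem_range.1 hk; omega)
  linarith

lemma bStar_eq (d : ℕ → ℝ) (a : ℕ → ℕ → ℝ) (hadiag : ∀ j, HasSum (fun i => a i j) 0)
    (i j : ℕ) : bStar d a (i + 1) (j + 1) = d (i + 1) / d (j + 1) * diffS a i j := by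
  unfold bStar
  congr 1
  have h : ∀ k, bEntry a (i + 1 + k) (j + 1) - bEntry a (i + 1 + k) (j + 1 - 1)
      = a (i + 1 + k) (j + 1) - a (i + 1 + k) j := by
    intro k
    unfold bEntry
    rcases j with _ | j <;> simp
  simp_rw [h]
  exact ((hasSum_colT a hadiag (i + 1) (j + 1)).sub (hasSum_colT a hadiag (i + 1) j)).tsum_eq

lemma cont_tsum (q : ℝ → ℕ → ℝ) (c : ℕ → ℝ) (L : ℝ) (hq : ∀ j, Continuous fun u => q u j)
    (hq0 : ∀ u j, 0 ≤ q u j) (hq1 : ∀ u, HasSum (q u) 1) (hc : ∀ j, |c j| ≤ L) :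
    Continuous (fun u => ∑' j, c j * q u j) := by
  have hs : ∀ u, Summable (fun j => c j * q u j) := fun u =>
    Summable.of_norm_bounded ((hq1 u).summable.mul_left L) (fun j => by
      rw [Real.norm_eq_abs, abs_mul, abs_of_nonneg (hq0 u j)]
      exact mul_le_mul_of_nonneg_right (hc j) (hq0 u j))
  have hL : 0 ≤ L := (abs_nonneg _).trans (hc 0)
  have hdini : TendstoLocallyUniformly (fun n u => ∑ j ∈ Finset.range n, q u j)
      (fun _ => (1 : ℝ)) atTop := by
    apply Monotone.tendstoLocallyUniformly_of_forall_tendsto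
    · intro n; exact continuous_finsetSum _ fun j _ => hq j
    · intro m n hmn u
      exact Finset.sum_le_sum_of_subset_of_nonneg (Finset.range_mono hmn) fun j _ _ => hq0 u j
    · exact continuous_const
    · intro u; exact (hq1 u).tendsto_sum_nat
  have hlu : TendstoLocallyUniformly (fun n u => ∑ j ∈ Finset.range n, c j * q u j)
      (fun u => ∑' j, c j * q u j) atTop := by
    rw [Metric.tendstoLocallyUniformly_iff] at hdini ⊢
    intro ε hε x
    obtain ⟨t, ht, h⟩ := hdini (ε / (L + 1)) (by positivity) x
    refine ⟨t, ht, h.mono fun n hn y hy => ?_⟩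
    have h1 := hn y hy
    have e1 := (hs y).sum_add_tsum_nat_add n
    have e2 := (hq1 y).summable.sum_add_tsum_nat_add n
    rw [(hq1 y).tsum_eq] at e2
    rw [Real.dist_eq] at h1 ⊢
    have e3 : |∑' i, c (i + n) * q y (i + n)| ≤ L * ∑' i, q y (i + n) := by
      have := tsum_of_norm_bounded (f := fun i => c (i + n) * q y (i + n))
        ((((summable_nat_add_iff n).2 (hq1 y).summable).mul_left L).hasSum) (fun j => by
          rw [Real.norm_eq_abs, abs_mul, abs_of_nonneg (hq0 y _)]
          exact mul_le_mul_of_nonneg_right (hc _) (hq0 y _))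
      rwa [tsum_mul_left] at this
    have e4 : 0 ≤ ∑' i, q y (i + n) := tsum_nonneg fun i => hq0 y _
    rw [← e1, add_sub_cancel_left]
    rw [← e2, add_sub_cancel_left, abs_of_nonneg e4, lt_div_iff₀ (by positivity)] at h1
    nlinarith
  exact hlu.continuous (Filter.Frequently.of_forall fun n =>
    continuous_finsetSum _ fun j _ => (hq j).const_mul _)

/-- Foster-Lyapunov drift bound, tested on a truncation. -/
lemma lyap (a : ℕ → ℕ → ℝ) (w : ℕ → ℝ) (α F : ℝ) (hw : ∀ i, 0 < w i)
    (haoff : ∀ i j, i ≠ j → 0 ≤ a i j)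
    (hadiag : ∀ j, HasSum (fun i => a i j) 0)
    (hS : ∀ j, ∃ x, HasSum (fun i => w i * diffS a i j) x ∧ x ≤ -α * w j)
    (hF : HasSum (fun i => w i * colT a (i + 1) 0) F)
    (q g : ℕ → ℝ) (hq0 : ∀ i, 0 ≤ q i) (hq1 : HasSum q 1)
    (hg : ∀ i, HasSum (fun j => a i j * q j) (g i)) (n : ℕ) :
    ∑ k ∈ Finset.range n, w k * (-∑ i ∈ Finset.range (k + 1), g i)
      ≤ F - α * ∑ j ∈ Finset.range n, q j * ∑ m ∈ Finset.range j, w m := by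
  have hF0 : 0 ≤ F := hF.nonneg fun i =>
    mul_nonneg (hw i).le (colT_nonneg a haoff hadiag _ _ (by omega))
  have hV : HasSum (fun j => (∑ k ∈ Finset.range n, w k * colT a (k + 1) j) * q j)
      (∑ k ∈ Finset.range n, w k * (-∑ i ∈ Finset.range (k + 1), g i)) := by
    have : (fun j => (∑ k ∈ Finset.range n, w k * colT a (k + 1) j) * q j) =
        fun j => ∑ k ∈ Finset.range n, w k * (-∑ i ∈ Finset.range (k + 1), a i j * q j) := by
      ext j
      rw [Finset.sum_mul]
      refine Finset.sum_congr rfl fun k _ => ?_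
      rw [← Finset.sum_mul, colT]; ring
    rw [this]
    exact hasSum_sum fun k _ => ((hasSum_sum fun i _ => hg i).neg).mul_left _
  have hcol : ∀ j, ∃ x, HasSum (fun i => w i * colT a (i + 1) j) x ∧
      x ≤ F - α * ∑ m ∈ Finset.range j, w m := by
    intro j
    induction j with
    | zero => exact ⟨F, hF, by simp⟩
    | succ j ih =>
      obtain ⟨x, hx, hx'⟩ := ih
      obtain ⟨y, hy, hy'⟩ := hS j
      refine ⟨x + y, ?_, ?_⟩
      · convert hx.add hy using 2 with i
        rw [diffS]; ring
      · rw [Finset.sum_range_succ]; linarith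
  have hle : ∀ j ∈ Finset.range n, ∑ k ∈ Finset.range n, w k * colT a (k + 1) j
      ≤ F - α * ∑ m ∈ Finset.range j, w m := by
    intro j hj
    obtain ⟨x, hx, hx'⟩ := hcol j
    refine le_trans (sum_le_hasSum _ (fun i hi => ?_) hx) hx'
    simp at hi hj
    exact mul_nonneg (hw i).le (colT_nonneg a haoff hadiag _ _ (by omega))
  have h0 : ∀ j, j ∉ Finset.range n → (∑ k ∈ Finset.range n, w k * colT a (k + 1) j) * q j ≤ 0 := by
    intro j hj
    refine mul_nonpos_of_nonpos_of_nonneg (Finset.sum_nonpos fun k hk => ?_) (hq0 j)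
    simp at hj hk
    exact mul_nonpos_of_nonneg_of_nonpos (hw k).le (colT_nonpos a haoff _ _ (by omega))
  have h1 := sum_le_hasSum (Finset.range n) (fun j hj => neg_nonneg.2 (h0 j hj)) hV.neg
  have h2 : ∑ j ∈ Finset.range n, (∑ k ∈ Finset.range n, w k * colT a (k + 1) j) * q j
      ≤ ∑ j ∈ Finset.range n, (F - α * ∑ m ∈ Finset.range j, w m) * q j :=
    Finset.sum_le_sum fun j hj => mul_le_mul_of_nonneg_right (hle j hj) (hq0 j)
  have h3 : ∑ j ∈ Finset.range n, (F - α * ∑ m ∈ Finset.range j, w m) * q j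
      = F * ∑ j ∈ Finset.range n, q j
        - α * ∑ j ∈ Finset.range n, q j * ∑ m ∈ Finset.range j, w m := by
    rw [Finset.mul_sum, Finset.mul_sum, ← Finset.sum_sub_distrib]
    exact Finset.sum_congr rfl fun j _ => by ring
  have h4 : ∑ j ∈ Finset.range n, q j ≤ 1 := sum_le_hasSum _ (fun i _ => hq0 i) hq1
  rw [Finset.sum_neg_distrib] at h1
  nlinarith

lemma tail_bound (w q : ℕ → ℝ) (C : ℝ) (hw : ∀ i, 0 < w i) (hq0 : ∀ i, 0 ≤ q i)
    (hq1 : HasSum q 1)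
    (h : ∀ n, ∑ j ∈ Finset.range n, q j * ∑ m ∈ Finset.range j, w m ≤ C) (N : ℕ) :
    ∑ k ∈ Finset.range N, w k * (1 - ∑ j ∈ Finset.range (k + 1), q j) ≤ C := by
  have ht : Tendsto (fun M => ∑ k ∈ Finset.range N, w k *
      (∑ j ∈ Finset.range M, q j - ∑ j ∈ Finset.range (k + 1), q j)) atTop
      (𝓝 (∑ k ∈ Finset.range N, w k * (1 - ∑ j ∈ Finset.range (k + 1), q j))) :=
    tendsto_finsetSum _ fun k _ => (hq1.tendsto_sum_nat.sub_const _).const_mul _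
  refine le_of_tendsto ht (eventually_atTop.2 ⟨N, fun M hM => le_trans ?_ (h M)⟩)
  have e1 : ∀ k ∈ Finset.range N, w k *
      (∑ j ∈ Finset.range M, q j - ∑ j ∈ Finset.range (k + 1), q j)
      = ∑ j ∈ Finset.range M, if k < j then w k * q j else 0 := by
    intro k hk
    simp at hk
    have : (Finset.range M).filter (fun j => k < j) = Finset.Ico (k + 1) M := by
      ext j; simp; omega
    rw [← Finset.sum_filter, this, ← Finset.sum_Ico_eq_sub _ (by omega), Finset.mul_sum]
  rw [Finset.sum_congr rfl e1, Finset.sum_comm]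
  refine Finset.sum_le_sum fun j hj => ?_
  rw [Finset.mul_sum, ← Finset.sum_filter]
  calc ∑ k ∈ (Finset.range N).filter (fun k => k < j), w k * q j
      ≤ ∑ k ∈ Finset.range j, w k * q j :=
        Finset.sum_le_sum_of_subset_of_nonneg (fun k hk => by simp at hk ⊢; exact hk.2)
          fun k _ _ => mul_nonneg (hw k).le (hq0 j)
    _ = _ := Finset.sum_congr rfl fun k _ => by ring

/-- Abel summation. -/
lemma abel_sum (t y x : ℕ → ℝ) (C s r : ℝ) (ht : ∀ j, |t j| ≤ C)
    (hx0 : x 0 = -y 0) (hx : ∀ j, x (j + 1) = y j - y (j + 1))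
    (hy : Tendsto y atTop (𝓝 0))
    (h1 : HasSum (fun j => t j * x j) s) (h2 : HasSum (fun j => (t (j + 1) - t j) * y j) r) :
    s = r := by
  have e : ∀ n, ∑ j ∈ Finset.range (n + 1), t j * x j
      = ∑ j ∈ Finset.range n, (t (j + 1) - t j) * y j - t n * y n := by
    intro n
    induction n with
    | zero => simp [hx0]
    | succ n ih => rw [Finset.sum_range_succ, ih, Finset.sum_range_succ, hx]; ring
  have l1 := (tendsto_add_atTop_iff_nat 1).2 h1.tendsto_sum_nat
  simp_rw [e] at l1
  have l2 : Tendsto (fun n => t n * y n) atTop (𝓝 0) := by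
    have : Tendsto (fun n => C * |y n|) atTop (𝓝 0) := by simpa using hy.abs.const_mul C
    refine squeeze_zero_norm (fun n => ?_) this
    rw [Real.norm_eq_abs, abs_mul]
    exact mul_le_mul_of_nonneg_right (ht n) (abs_nonneg _)
  have l3 := h2.tendsto_sum_nat.sub l2
  rw [sub_zero] at l3
  exact tendsto_nhds_unique l1 l3

/-- pointwise estimate of the positive operator `S + c` in the weighted norm. -/
lemma op_bound (a : ℕ → ℕ → ℝ) (w y : ℕ → ℝ) (α L c B : ℝ) (hw : ∀ i, 1 ≤ w i)
    (hSoff : ∀ i j, i ≠ j → 0 ≤ diffS a i j) (hSb : ∀ i j, |diffS a i j| ≤ 2 * L)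
    (hc : 2 * L ≤ c) (hcα : α ≤ c)
    (hS : ∀ j, ∃ x, HasSum (fun i => w i * diffS a i j) x ∧ x ≤ -α * w j)
    (hy : ∀ N, ∑ i ∈ Finset.range N, w i * |y i| ≤ B) (N : ℕ) :
    ∑ i ∈ Finset.range N, w i * |c * y i + ∑' j, diffS a i j * y j| ≤ (c - α) * B := by
  have hw0 : ∀ i, 0 < w i := fun i => lt_of_lt_of_le one_pos (hw i)
  have hsy : Summable (fun j => w j * |y j|) :=
    summable_of_sum_range_le (fun j => mul_nonneg (hw0 j).le (abs_nonneg _)) hy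
  have hB : ∑' j, w j * |y j| ≤ B :=
    Real.tsum_le_of_sum_range_le (fun j => mul_nonneg (hw0 j).le (abs_nonneg _)) hy
  have hya : Summable (fun j => |y j|) := Summable.of_nonneg_of_le (fun j => abs_nonneg _)
    (fun j => le_mul_of_one_le_left (abs_nonneg _) (hw j)) hsy
  set R : ℕ → ℕ → ℝ := fun i j => diffS a i j + if j = i then c else 0 with hR
  have hR0 : ∀ i j, 0 ≤ R i j := by
    intro i j
    simp only [hR]
    split_ifs with h
    · have := (abs_le.1 (hSb i j)).1; linarith
    · simpa using hSoff i j (Ne.symm h)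
  have hsS : ∀ i, Summable (fun j => diffS a i j * y j) := fun i =>
    Summable.of_norm_bounded (hya.mul_left (2 * L)) (fun j => by
      rw [Real.norm_eq_abs, abs_mul]
      exact mul_le_mul_of_nonneg_right (hSb i j) (abs_nonneg _))
  have hRy : ∀ i, HasSum (fun j => R i j * y j) (c * y i + ∑' j, diffS a i j * y j) := by
    intro i
    rw [add_comm]
    convert (hsS i).hasSum.add (hasSum_ite_eq i (c * y i)) using 2 with j
    simp only [hR]
    split_ifs with h
    · subst h; ring
    · ring
  have hRs : ∀ i, Summable (fun j => R i j * |y j|) := by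
    intro i
    have := (hRy i).summable.abs
    refine this.congr fun j => ?_
    rw [abs_mul, abs_of_nonneg (hR0 i j)]
  have h1 : ∀ i, |c * y i + ∑' j, diffS a i j * y j| ≤ ∑' j, R i j * |y j| := by
    intro i
    rw [← (hRy i).tsum_eq]
    have := tsum_of_norm_bounded (f := fun j => R i j * y j) (hRs i).hasSum (fun j => by
      rw [Real.norm_eq_abs, abs_mul, abs_of_nonneg (hR0 i j)])
    exact this
  have hcol : ∀ j, ∑ i ∈ Finset.range N, w i * R i j ≤ (c - α) * w j := by
    intro j
    obtain ⟨x, hx, hx'⟩ := hS j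
    have : HasSum (fun i => w i * R i j) (x + c * w j) := by
      convert hx.add (hasSum_ite_eq j (c * w j)) using 2 with i
      simp only [hR]
      by_cases h : i = j
      · subst h; simp; ring
      · simp [h, Ne.symm h]
    have := sum_le_hasSum (Finset.range N) (fun i _ => mul_nonneg (hw0 i).le (hR0 i j)) this
    linarith
  calc ∑ i ∈ Finset.range N, w i * |c * y i + ∑' j, diffS a i j * y j|
      ≤ ∑ i ∈ Finset.range N, w i * ∑' j, R i j * |y j| :=
        Finset.sum_le_sum fun i _ => mul_le_mul_of_nonneg_left (h1 i) (hw0 i).le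
    _ = ∑ i ∈ Finset.range N, ∑' j, w i * (R i j * |y j|) := by simp_rw [tsum_mul_left]
    _ = ∑' j, ∑ i ∈ Finset.range N, w i * (R i j * |y j|) :=
        (Summable.tsum_finsetSum fun i _ => (hRs i).mul_left _).symm
    _ ≤ ∑' j, (c - α) * (w j * |y j|) := by
        refine Summable.tsum_le_tsum (fun j => ?_)
          (summable_sum fun i _ => (hRs i).mul_left _) (hsy.mul_left _)
        have := mul_le_mul_of_nonneg_right (hcol j) (abs_nonneg (y j))
        rw [Finset.sum_mul] at this
        calc _ = ∑ i ∈ Finset.range N, w i * R i j * |y j| :=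
              Finset.sum_congr rfl fun i _ => by ring
          _ ≤ _ := this
          _ = _ := by ring
    _ = (c - α) * ∑' j, w j * |y j| := tsum_mul_left
    _ ≤ (c - α) * B := mul_le_mul_of_nonneg_left hB (by linarith)

/-- Picard iteration of the integral inequality. -/
lemma picard (Y Z : ℕ → ℝ → ℝ) (w : ℕ → ℝ) (hw : ∀ i, 0 < w i) (c K A M T : ℝ)
    (hK : 0 ≤ K) (hA : 0 ≤ A)
    (hZc : ∀ i, Continuous (Z i)) (hY : ∀ i t, HasDerivAt (Y i) (Z i t) t)
    (hop : ∀ s ∈ Set.Icc 0 T, ∀ B, (∀ N, ∑ i ∈ Finset.range N, w i * |Y i s| ≤ B) →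
      ∀ N, ∑ i ∈ Finset.range N, w i * |c * Y i s + Z i s| ≤ K * B)
    (h0 : ∀ N, ∑ i ∈ Finset.range N, w i * |Y i 0| ≤ A)
    (hM : ∀ s ∈ Set.Icc 0 T, ∀ N, Real.exp (c * s) * ∑ i ∈ Finset.range N, w i * |Y i s| ≤ M) :
    ∀ s ∈ Set.Icc 0 T, ∀ N,
      Real.exp (c * s) * ∑ i ∈ Finset.range N, w i * |Y i s| ≤ A * Real.exp (K * s) := by
  have hYc : ∀ i, Continuous (Y i) := fun i =>
    continuous_iff_continuousAt.2 fun t => (hY i t).continuousAt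
  have key : ∀ n : ℕ, ∀ s ∈ Set.Icc 0 T, ∀ N,
      Real.exp (c * s) * ∑ i ∈ Finset.range N, w i * |Y i s|
        ≤ A * Real.exp (K * s) + M * ((K * s) ^ n / n.factorial) := by
    intro n
    induction n with
    | zero =>
      intro s hs N
      have := hM s hs N
      have : 0 ≤ A * Real.exp (K * s) := by positivity
      simp
      linarith [hM s hs N]
    | succ n ih =>
      intro t ht N
      have hi : ∀ i, w i * (Real.exp (c * t) * |Y i t|) ≤ w i * |Y i 0| +
          ∫ s in (0:ℝ)..t, w i * (Real.exp (c * s) * |c * Y i s + Z i s|) := by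
        intro i
        have hder : ∀ s, HasDerivAt (fun s => Real.exp (c * s) * Y i s)
            (Real.exp (c * s) * (c * Y i s + Z i s)) s := by
          intro s
          have h1 : HasDerivAt (fun s => Real.exp (c * s)) (Real.exp (c * s) * (c * 1)) s :=
            ((hasDerivAt_id s).const_mul c).exp
          exact (h1.mul (hY i s)).congr_deriv (by ring)
        have hcont : Continuous (fun s => Real.exp (c * s) * (c * Y i s + Z i s)) := by
          have := hYc i
          have := hZc i
          fun_prop
        have e := intervalIntegral.integral_eq_sub_of_hasDerivAt (a := 0) (b := t)
          (fun s _ => hder s) (hcont.intervalIntegrable _ _)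
        have e2 := intervalIntegral.norm_integral_le_integral_norm (μ := volume) (f := fun s => Real.exp (c * s) * (c * Y i s + Z i s)) ht.1
        rw [e] at e2
        simp only [Real.norm_eq_abs, abs_mul, Real.abs_exp, mul_zero, Real.exp_zero, one_mul] at e2
        rw [intervalIntegral.integral_const_mul, ← mul_add]
        refine mul_le_mul_of_nonneg_left ?_ (hw i).le
        have e3 := abs_sub_abs_le_abs_sub (Real.exp (c * t) * Y i t) (Y i 0)
        rw [abs_mul, Real.abs_exp] at e3
        linarith
      have hIntble : ∀ i, IntervalIntegrable
          (fun s => w i * (Real.exp (c * s) * |c * Y i s + Z i s|)) volume 0 t := by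
        intro i
        apply Continuous.intervalIntegrable
        have := hYc i
        have := hZc i
        fun_prop
      have hprim : ∀ s, HasDerivAt (fun s => A * Real.exp (K * s) +
          M * ((K * s) ^ (n + 1) / (n + 1).factorial))
          (K * (A * Real.exp (K * s) + M * ((K * s) ^ n / n.factorial))) s := by
        intro s
        have h1 : HasDerivAt (fun s => K * s) (K * 1) s := (hasDerivAt_id s).const_mul K
        refine ((h1.exp.const_mul A).add (((h1.pow (n + 1)).div_const _).const_mul M)).congr_deriv ?_
        rw [Nat.factorial_succ]
        have : (n.factorial : ℝ) ≠ 0 := by positivity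
        push_cast
        field_simp
      have hbc : Continuous (fun s => K * (A * Real.exp (K * s) + M * ((K * s) ^ n / n.factorial))) := by
        fun_prop
      have e4 := intervalIntegral.integral_eq_sub_of_hasDerivAt (a := 0) (b := t)
          (fun s _ => hprim s) (hbc.intervalIntegrable _ _)
      have hmono : ∫ s in (0:ℝ)..t, ∑ i ∈ Finset.range N,
          w i * (Real.exp (c * s) * |c * Y i s + Z i s|) ≤
          ∫ s in (0:ℝ)..t, K * (A * Real.exp (K * s) + M * ((K * s) ^ n / n.factorial)) := by
        refine intervalIntegral.integral_mono_on ht.1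
          ((IntervalIntegrable.sum (Finset.range N) fun i _ => hIntble i).congr (fun s _ => by simp)) (hbc.intervalIntegrable _ _) ?_
        intro s hs
        have hs' : s ∈ Set.Icc 0 T := ⟨hs.1, hs.2.trans ht.2⟩
        have hB := hop s hs' ((A * Real.exp (K * s) + M * ((K * s) ^ n / n.factorial)) /
          Real.exp (c * s)) (fun N => by
            rw [le_div_iff₀ (Real.exp_pos _), mul_comm]
            exact ih s hs' N) N
        rw [← mul_div_assoc, le_div_iff₀ (Real.exp_pos _), Finset.sum_mul] at hB
        refine le_trans (le_of_eq ?_) hB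
        exact Finset.sum_congr rfl fun i _ => by ring
      rw [intervalIntegral.integral_finsetSum fun i _ => hIntble i] at hmono
      have hsum := Finset.sum_le_sum fun i (_ : i ∈ Finset.range N) => hi i
      rw [Finset.sum_add_distrib] at hsum
      have e5 : Real.exp (c * t) * ∑ i ∈ Finset.range N, w i * |Y i t|
          = ∑ i ∈ Finset.range N, w i * (Real.exp (c * t) * |Y i t|) := by
        rw [Finset.mul_sum]; exact Finset.sum_congr rfl fun i _ => by ring
      rw [e5]
      simp only [mul_zero, Real.exp_zero, mul_one, ne_eq, Nat.add_eq_zero_iff, one_ne_zero,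
        and_false, not_false_eq_true, zero_pow, zero_div, add_zero] at e4
      have := h0 N
      linarith
  intro s hs N
  have l := (FloorSemiring.tendsto_pow_div_factorial_atTop (K * s)).const_mul M
  have l2 := l.const_add (A * Real.exp (K * s))
  simp only [mul_zero, add_zero] at l2
  exact ge_of_tendsto' l2 fun n => key n s hs N

/-- the `l¹` norm is controlled by the sums of tails -/
lemma l1_bound (w x y : ℕ → ℝ) (B : ℝ) (hw : ∀ i, 1 ≤ w i)
    (hx0 : x 0 = -y 0) (hx : ∀ j, x (j + 1) = y j - y (j + 1))
    (hB : ∀ N, ∑ i ∈ Finset.range N, w i * |y i| ≤ B) :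
    ∑' i, |x i| ≤ 2 * B := by
  have hy : ∀ N, ∑ i ∈ Finset.range N, |y i| ≤ B := fun N =>
    (Finset.sum_le_sum fun i _ => le_mul_of_one_le_left (abs_nonneg _) (hw i)).trans (hB N)
  refine Real.tsum_le_of_sum_range_le (fun _ => abs_nonneg _) fun n => ?_
  have : ∀ n, ∑ i ∈ Finset.range (n + 1), |x i| ≤
      ∑ i ∈ Finset.range (n + 1), |y i| + ∑ i ∈ Finset.range n, |y i| := by
    intro n
    rw [Finset.sum_range_succ', Finset.sum_range_succ' (fun i => |y i|), hx0, abs_neg]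
    have : ∑ i ∈ Finset.range n, |x (i + 1)| ≤
        ∑ i ∈ Finset.range n, (|y (i + 1)| + |y i|) := Finset.sum_le_sum fun i _ => by
      rw [hx]; exact (abs_sub (y i) (y (i + 1))).trans (le_of_eq (add_comm _ _))
    rw [Finset.sum_add_distrib] at this
    linarith
  calc _ ≤ ∑ i ∈ Finset.range (n + 1), |x i| :=
        Finset.sum_le_sum_of_subset_of_nonneg (Finset.range_mono (by omega))
          fun _ _ _ => abs_nonneg _
    _ ≤ _ := this n
    _ ≤ 2 * B := by linarith [hy n, hy (n + 1)]

/-- Corollary 1, bound (cor001).  For a homogeneous chain with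
nonnegative off-diagonal entries of `D B D⁻¹` and `α = inf_i α_i > 0`, let `π` be a
stationary stochastic vector and `F = ‖f‖_{1D} = Σ_{k≥1} d_k Σ_{i≥k} a_{i0} < ∞`, where
`f = (a_{10}, a_{20}, …)`.  Then `‖z_π‖_{1D} ≤ F/α`, and the solution `p` with
`p(0) = e_0` satisfies `‖π − p(t)‖ ≤ (4F/α)·e^{−αt}` for all `t ≥ 0`. -/
theorem cor1_cor001
    (a : ℕ → ℕ → ℝ) (d : ℕ → ℝ) (L : ℝ)
    (hd1 : d 1 = 1) (hdpos : ∀ k, 1 ≤ k → 0 < d k)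
    (hdmono : ∀ k, 1 ≤ k → d k ≤ d (k + 1))
    (haoff : ∀ i j, i ≠ j → 0 ≤ a i j)
    (hadiag : ∀ j, HasSum (fun i => a i j) 0)
    (haL : ∀ j, |a j j| ≤ L)
    (hbstar : ∀ i j, 1 ≤ i → 1 ≤ j → i ≠ j → 0 ≤ bStar d a i j)
    (α : ℝ) (hα : α = ⨅ i : ℕ, alphaI d a (i + 1)) (hαpos : 0 < α)
    (F : ℝ) (hF : F = ∑' k : ℕ, d (k + 1) * ∑' i : ℕ, a (k + 1 + i) 0)
    (hFfin : Summable (fun k : ℕ => d (k + 1) * ∑' i : ℕ, a (k + 1 + i) 0))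
    (π : ℕ → ℝ) (hπpos : ∀ i, 0 ≤ π i) (hπsum : HasSum π 1)
    (hπstat : ∀ i, HasSum (fun j => a i j * π j) 0)
    (p : ℝ → ℕ → ℝ) (hp : IsKolmogorovSolution a p)
    (hp0 : ∀ i : ℕ, p 0 i = if i = 0 then 1 else 0) :
    (Norm1DFinite d π ∧ norm1D d π ≤ F / α) ∧
    (∀ t : ℝ, 0 ≤ t →
      (∑' i : ℕ, |π i - p t i|) ≤ (4 * F / α) * Real.exp (-α * t)) := by
  set w : ℕ → ℝ := fun i => d (i + 1) with hwdef
  have hw1 : ∀ i, 1 ≤ w i := by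
    intro i
    induction i with
    | zero => simp [hwdef, hd1]
    | succ i ih => exact ih.trans (hdmono (i + 1) (by omega))
  have hw : ∀ i, 0 < w i := fun i => lt_of_lt_of_le one_pos (hw1 i)
  have hSoff : ∀ i j, i ≠ j → 0 ≤ diffS a i j := by
    intro i j hij
    have h := hbstar (i + 1) (j + 1) (by omega) (by omega) (by omega)
    rw [bStar_eq d a hadiag] at h
    exact nonneg_of_mul_nonneg_right h (div_pos (hw i) (hw j))
  have hTb := abs_colT_le a L haoff hadiag haL
  have hab := abs_a_le a L haoff hadiag haL
  have hL0 : 0 ≤ L := (abs_nonneg _).trans (haL 0)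
  have hSb : ∀ i j, |diffS a i j| ≤ 2 * L := by
    intro i j
    have := abs_sub (colT a (i + 1) (j + 1)) (colT a (i + 1) j)
    unfold diffS
    linarith [hTb (i + 1) (j + 1), hTb (i + 1) j]
  have hαle : ∀ j, α ≤ alphaI d a (j + 1) := by
    intro j
    rw [hα]
    refine ciInf_le ?_ j
    by_contra hb
    rw [Real.iInf_of_not_bddBelow hb] at hα
    linarith
  have hS : ∀ j, ∃ x, HasSum (fun i => w i * diffS a i j) x ∧ x ≤ -α * w j := by
    intro j
    have h := hαle j
    unfold alphaI at h
    simp_rw [bStar_eq d a hadiag] at h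
    have hsum : Summable (fun i => d (i + 1) / d (j + 1) * diffS a i j) := by
      by_contra hn
      rw [tsum_eq_zero_of_not_summable hn] at h
      linarith
    have e : (fun i => w i * diffS a i j) =
        fun i => w j * (d (i + 1) / d (j + 1) * diffS a i j) := by
      ext i
      have := (hw j).ne'
      simp only [hwdef] at this ⊢
      field_simp
    refine ⟨w j * ∑' i, d (i + 1) / d (j + 1) * diffS a i j, ?_, ?_⟩
    · rw [e]; exact hsum.hasSum.mul_left _
    · have := hw j
      nlinarith
  have hFs : HasSum (fun i => w i * colT a (i + 1) 0) F := by
    have e : ∀ k, ∑' i : ℕ, a (k + 1 + i) 0 = colT a (k + 1) 0 := fun k =>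
      (hasSum_colT a hadiag (k + 1) 0).tsum_eq
    simp_rw [e] at hF hFfin
    rw [hF]; exact hFfin.hasSum
  have hF0 : 0 ≤ F := hFs.nonneg fun i =>
    mul_nonneg (hw i).le (colT_nonneg a haoff hadiag _ _ (by omega))
  -- stationary vector
  have hπN : ∀ N, ∑ k ∈ Finset.range N, w k * (1 - ∑ j ∈ Finset.range (k + 1), π j) ≤ F / α := by
    refine tail_bound w π _ hw hπpos hπsum fun n => ?_
    have := lyap a w α F hw haoff hadiag hS hFs π (fun _ => 0) hπpos hπsum hπstat n
    simp at this
    rw [le_div_iff₀ hαpos]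
    linarith
  have htail0 : ∀ q : ℕ → ℝ, (∀ i, 0 ≤ q i) → HasSum q 1 → ∀ n,
      0 ≤ 1 - ∑ j ∈ Finset.range n, q j := fun q h0 h1 n =>
    sub_nonneg.2 (sum_le_hasSum _ (fun i _ => h0 i) h1)
  have hπabs : ∀ k, |∑' i : ℕ, π (k + 1 + i)| = 1 - ∑ j ∈ Finset.range (k + 1), π j := by
    intro k
    have h := (hasSum_nat_add_iff' (k + 1)).2 hπsum
    have h' : HasSum (fun i => π (k + 1 + i)) (1 - ∑ j ∈ Finset.range (k + 1), π j) := by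
      simpa [add_comm] using h
    rw [h'.tsum_eq, abs_of_nonneg (htail0 π hπpos hπsum _)]
  refine ⟨⟨?_, ?_⟩, ?_⟩
  · unfold Norm1DFinite
    simp_rw [hπabs]
    exact summable_of_sum_range_le (c := F / α)
      (fun k => mul_nonneg (hw k).le (htail0 π hπpos hπsum _)) hπN
  · unfold norm1D
    simp_rw [hπabs]
    exact Real.tsum_le_of_sum_range_le
      (fun k => mul_nonneg (hw k).le (htail0 π hπpos hπsum _)) hπN
  intro T hT
  obtain ⟨hp1, hp2⟩ := hp
  -- regularised solution
  set q : ℝ → ℕ → ℝ := fun u => p (max u 0) with hqdef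
  have hq0 : ∀ u j, 0 ≤ q u j := fun u => (hp1 _ (le_max_right _ _)).1
  have hq1 : ∀ u, HasSum (q u) 1 := fun u => (hp1 _ (le_max_right _ _)).2
  have hqs : ∀ u i, HasSum (fun j => a i j * q u j) (∑' j, a i j * q u j) := fun u i =>
    (Summable.of_norm_bounded ((hq1 u).summable.mul_left L) (fun j => by
      rw [Real.norm_eq_abs, abs_mul, abs_of_nonneg (hq0 u j)]
      exact mul_le_mul_of_nonneg_right (hab i j) (hq0 u j))).hasSum
  have hGb : ∀ u, 0 ≤ u → ∀ i, ‖∑' j, a i j * p u j‖ ≤ L := by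
    intro u hu i
    obtain ⟨h0, h1⟩ := hp1 u hu
    have := tsum_of_norm_bounded (f := fun j => a i j * p u j) (h1.mul_left L) (fun j => by
      rw [Real.norm_eq_abs, abs_mul, abs_of_nonneg (h0 j)]
      exact mul_le_mul_of_nonneg_right (hab i j) (h0 j))
    simpa using this
  have hlip : ∀ i s t, 0 ≤ s → s ≤ t → |p t i - p s i| ≤ L * |t - s| := by
    intro i s t hs hst
    rw [hp2 i s t hs hst, add_sub_cancel_left]
    exact intervalIntegral.norm_integral_le_of_norm_le_const (C := L) fun u hu => by
      rw [Set.uIoc_of_le hst] at hu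
      exact hGb u (hs.trans hu.1.le) i
  have hqc : ∀ j, Continuous fun u => q u j := by
    intro j
    have hL1 : LipschitzOnWith (Real.toNNReal L) (fun u => p u j) (Set.Ici 0) := by
      refine LipschitzOnWith.of_dist_le_mul fun x hx y hy => ?_
      rw [Real.dist_eq, Real.dist_eq, Real.coe_toNNReal _ hL0]
      rcases le_total x y with h | h
      · rw [abs_sub_comm, abs_sub_comm x]; exact hlip j x y hx h
      · exact hlip j y x hy h
    exact hL1.continuousOn.comp_continuous (continuous_id.max continuous_const)
      fun u => Set.mem_Ici.2 (le_max_right _ _)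
  set G : ℕ → ℝ → ℝ := fun i u => ∑' j, a i j * q u j with hG
  have hGc : ∀ i, Continuous (G i) := fun i => cont_tsum q (a i) L hqc hq0 hq1 (hab i)
  set r : ℕ → ℝ → ℝ := fun i t => p 0 i + ∫ u in (0:ℝ)..t, G i u with hr
  have hrd : ∀ i t, HasDerivAt (r i) (G i t) t := fun i t =>
    (intervalIntegral.integral_hasDerivAt_right ((hGc i).intervalIntegrable _ _)
      (hGc i).stronglyMeasurable.stronglyMeasurableAtFilter (hGc i).continuousAt).const_add _
  have hrq : ∀ i t, 0 ≤ t → r i t = q t i := by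
    intro i t ht
    simp only [hr, hqdef, max_eq_left ht]
    rw [hp2 i 0 t le_rfl ht]
    congr 1
    refine intervalIntegral.integral_congr fun u hu => ?_
    rw [Set.uIcc_of_le ht] at hu
    simp only [hG, hqdef, max_eq_left hu.1]
  have hqp : ∀ t, 0 ≤ t → q t = p t := fun t ht => by simp only [hqdef, max_eq_left ht]
  -- a priori bound for the tails of the solution
  have hE : ∀ t, 0 ≤ t → ∀ N,
      ∑ k ∈ Finset.range N, w k * (1 - ∑ j ∈ Finset.range (k + 1), q t j) ≤ F * t := by
    intro t ht N
    have hd : ∀ s, HasDerivAt (fun s => ∑ k ∈ Finset.range N, w k *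
        (1 - ∑ j ∈ Finset.range (k + 1), r j s))
        (∑ k ∈ Finset.range N, w k * (-∑ j ∈ Finset.range (k + 1), G j s)) s := by
      intro s
      exact HasDerivAt.fun_sum fun k _ =>
        ((HasDerivAt.fun_sum fun j _ => hrd j s).const_sub 1).const_mul (w k)
    have hc : Continuous fun s =>
        (∑ k ∈ Finset.range N, w k * (-∑ j ∈ Finset.range (k + 1), G j s)) := by
      fun_prop
    have e := intervalIntegral.integral_eq_sub_of_hasDerivAt (a := 0) (b := t)
      (fun s _ => hd s) (hc.intervalIntegrable _ _)
    have hle := intervalIntegral.integral_mono_on (μ := volume) ht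
      (hc.intervalIntegrable _ _) (continuous_const (y := F) |>.intervalIntegrable _ _)
      (fun s _ => by
        have h := lyap a w α F hw haoff hadiag hS hFs (q s) (fun i => G i s) (hq0 s) (hq1 s)
          (hqs s) N
        have : 0 ≤ ∑ j ∈ Finset.range N, q s j * ∑ m ∈ Finset.range j, w m :=
          Finset.sum_nonneg fun j _ => mul_nonneg (hq0 s j)
            (Finset.sum_nonneg fun m _ => (hw m).le)
        have := mul_nonneg hαpos.le this
        linarith)
    rw [e] at hle
    have h0 : ∀ k, 1 - ∑ j ∈ Finset.range (k + 1), r j 0 = 0 := by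
      intro k
      simp [hr, hp0]
    simp_rw [h0] at hle
    simp_rw [hrq _ t ht] at hle
    simp at hle
    linarith
  set Y : ℕ → ℝ → ℝ := fun i t => ∑ k ∈ Finset.range (i + 1), (π k - r k t) with hY
  set Z : ℕ → ℝ → ℝ := fun i t => -∑ k ∈ Finset.range (i + 1), G k t with hZ
  have hYd : ∀ i t, HasDerivAt (Y i) (Z i t) t := by
    intro i t
    have := HasDerivAt.fun_sum (u := Finset.range (i + 1)) fun k _ => (hrd k t).const_sub (π k)
    exact this.congr_deriv (by simp [hZ])
  have hZc : ∀ i, Continuous (Z i) := fun i => by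
    simp only [hZ]; fun_prop
  have hYq : ∀ i t, 0 ≤ t → Y i t = (1 - ∑ j ∈ Finset.range (i + 1), q t j)
      - (1 - ∑ j ∈ Finset.range (i + 1), π j) := by
    intro i t ht
    simp only [hY, hrq _ t ht, Finset.sum_sub_distrib]
    ring
  have hYb : ∀ t, 0 ≤ t → ∀ N, ∑ i ∈ Finset.range N, w i * |Y i t| ≤ F * t + F / α := by
    intro t ht N
    have : ∑ i ∈ Finset.range N, w i * |Y i t| ≤
        ∑ i ∈ Finset.range N, (w i * (1 - ∑ j ∈ Finset.range (i + 1), q t j)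
          + w i * (1 - ∑ j ∈ Finset.range (i + 1), π j)) := by
      refine Finset.sum_le_sum fun i _ => ?_
      rw [← mul_add]
      refine mul_le_mul_of_nonneg_left ?_ (hw i).le
      rw [hYq i t ht]
      have h1 := htail0 (q t) (hq0 t) (hq1 t) (i + 1)
      have h2 := htail0 π hπpos hπsum (i + 1)
      rw [abs_le]; constructor <;> linarith
    rw [Finset.sum_add_distrib] at this
    linarith [hE t ht N, hπN N]
  have hYx0 : ∀ t, 0 ≤ t → q t 0 - π 0 = -Y 0 t := by
    intro t ht
    simp [hY, hrq _ t ht]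
  have hYx : ∀ t, 0 ≤ t → ∀ j, q t (j + 1) - π (j + 1) = Y j t - Y (j + 1) t := by
    intro t ht j
    simp only [hY]
    rw [Finset.sum_range_succ _ (j + 1), hrq _ t ht]
    ring
  have hZS : ∀ t, 0 ≤ t → ∀ i, Z i t = ∑' j, diffS a i j * Y j t := by
    intro t ht i
    have hsw : Summable (fun j => w j * |Y j t|) :=
      summable_of_sum_range_le (fun j => mul_nonneg (hw j).le (abs_nonneg _)) (hYb t ht)
    have hya : Summable (fun j => |Y j t|) := Summable.of_nonneg_of_le (fun j => abs_nonneg _)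
      (fun j => le_mul_of_one_le_left (abs_nonneg _) (hw1 j)) hsw
    have hsS : Summable (fun j => diffS a i j * Y j t) :=
      Summable.of_norm_bounded (hya.mul_left (2 * L)) (fun j => by
        rw [Real.norm_eq_abs, abs_mul]
        exact mul_le_mul_of_nonneg_right (hSb i j) (abs_nonneg _))
    refine abel_sum (colT a (i + 1)) (fun j => Y j t) (fun j => q t j - π j) L _ _ (hTb (i + 1))
      (hYx0 t ht) (hYx t ht) hya.of_abs.tendsto_atTop_zero ?_ hsS.hasSum
    have h1 := (hasSum_sum fun k (_ : k ∈ Finset.range (i + 1)) =>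
      (hqs t k).sub (hπstat k)).neg
    simp only [sub_zero] at h1
    refine (congrArg (fun f => HasSum f (Z i t)) (funext fun j => ?_)).mpr h1
    rw [colT, neg_mul, Finset.sum_mul]
    congr 1
    exact Finset.sum_congr rfl fun k _ => by ring
  have hmain := picard Y Z w hw (2 * L + α) (2 * L) (F / α)
    (Real.exp ((2 * L + α) * T) * (F * T + F / α)) T (by linarith) (by positivity) hZc hYd
    (fun s hs B hB N => by
      have := op_bound a w (fun i => Y i s) α L (2 * L + α) B hw1 hSoff hSb (by linarith)
        (by linarith) hS hB N
      simp_rw [hZS s hs.1]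
      simpa using this)
    (fun N => by simpa using hYb 0 le_rfl N)
    (fun s hs N => by
      have h1 := hYb s hs.1 N
      have h2 : F * s ≤ F * T := mul_le_mul_of_nonneg_left hs.2 hF0
      have h3 : Real.exp ((2 * L + α) * s) ≤ Real.exp ((2 * L + α) * T) :=
        Real.exp_le_exp.2 (mul_le_mul_of_nonneg_left hs.2 (by linarith))
      exact mul_le_mul h3 (by linarith)
        (Finset.sum_nonneg fun i _ => mul_nonneg (hw i).le (abs_nonneg _)) (Real.exp_pos _).le)
    T ⟨hT, le_rfl⟩
  have hfin : ∀ N, ∑ i ∈ Finset.range N, w i * |Y i T| ≤ F / α * Real.exp (-α * T) := by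
    intro N
    have h := hmain N
    have e : Real.exp (2 * L * T) = Real.exp ((2 * L + α) * T) * Real.exp (-α * T) := by
      rw [← Real.exp_add]; congr 1; ring
    rw [e] at h
    refine le_of_mul_le_mul_left ?_ (Real.exp_pos ((2 * L + α) * T))
    linarith
  have hl := l1_bound w (fun j => q T j - π j) (fun j => Y j T) _ hw1 (hYx0 T hT) (hYx T hT) hfin
  simp only [hqp T hT] at hl
  simp_rw [abs_sub_comm (π _)]
  refine hl.trans ?_
  have : 0 ≤ F / α * Real.exp (-α * T) := by positivity
  rw [mul_div_assoc]
  linarith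
end
end
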